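/- arXiv:2111.15223 — 3 statements merged into one kernel-verified Lean document; each statement's English description precedes it below -/
import Mathlib

section
/- Let n ≥ 0 and let X be an extension of the symplectic character ratio of size 2n+1. Define g : ℂ∖{0} → ℂ by g(z) = z^{−(2n+1)} (z−1)^{4n+1} (z+1) · X(1, …, 1, z), where the first 2n arguments of X equal 1. Then g is twice differentiable on ℂ∖{0}, and for every z with z ≠ 0 and z³ ≠ 1 one has z · d/dz( z·g′(z) ) + 6n · ((1+z³)/(1−z³)) · z·g′(z) + (3n+1)(3n−1) · g(z) = 0. -/
noncomputable section

/-- `δ_i = N − i + 1` for the 1-based index `i`; here `i : Fin N` is 0-based. -/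
def deltaE (N : ℕ) (i : Fin N) : ℕ := N - i.1

/-- `μ_i = λ_i + δ_i` with `λ_i = ⌊(N−i)/2⌋` for the 1-based index `i`. -/
def muE (N : ℕ) (i : Fin N) : ℕ := (N - i.1 - 1) / 2 + (N - i.1)

/-- The determinant `det_{i,j} (z_j^{e_i} − z_j^{−e_i})`. -/
def sdet (N : ℕ) (e : Fin N → ℕ) (z : Fin N → ℂ) : ℂ :=
  Matrix.det (Matrix.of fun i j : Fin N => z j ^ (e i : ℤ) - z j ^ (-(e i : ℤ)))

/-- `X` is a (continuous) extension of the symplectic character ratio of size `N`: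
it agrees with `det(z_j^{μ_i} − z_j^{−μ_i}) / det(z_j^{δ_i} − z_j^{−δ_i})`
whenever the denominator is nonzero. -/
def IsSymplecticExt (N : ℕ) (X : (Fin N → ℂ) → ℂ) : Prop :=
  ContinuousOn X {z : Fin N → ℂ | ∀ i, z i ≠ 0} ∧
  ∀ z : Fin N → ℂ, (∀ i, z i ≠ 0) → sdet N (deltaE N) z ≠ 0 →
    X z = sdet N (muE N) z / sdet N (deltaE N) z

/-- Binomial coefficient `C(a,b)` for integers, vanishing unless `0 ≤ b ≤ a`. -/
def zchoose (a b : ℤ) : ℤ := if 0 ≤ b ∧ b ≤ a then (a.toNat).choose b.toNat else 0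

open Polynomial Filter Topology

theorem chebyshevS_monic_natDegree (k : ℕ) :
    (Chebyshev.S ℂ k).Monic ∧ (Chebyshev.S ℂ k).natDegree = k := by
  induction k using Nat.strong_induction_on with
  | _ k ih =>
    match k, ih with
    | 0, _ => simp
    | 1, _ => simp [monic_X]
    | k + 2, ih =>
      obtain ⟨m0, d0⟩ := ih k (by omega)
      obtain ⟨m1, d1⟩ := ih (k + 1) (by omega)
      have e : Chebyshev.S ℂ ((k + 2 : ℕ) : ℤ)
          = X * Chebyshev.S ℂ ((k + 1 : ℕ) : ℤ) - Chebyshev.S ℂ (k : ℤ) := by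
        push_cast
        exact Chebyshev.S_add_two ℂ k
      have hm : (X * Chebyshev.S ℂ ((k + 1 : ℕ) : ℤ)).Monic := monic_X.mul m1
      have hn : (X * Chebyshev.S ℂ ((k + 1 : ℕ) : ℤ)).natDegree = k + 2 := by
        rw [monic_X.natDegree_mul m1, d1, natDegree_X]
        omega
      have hd : (Chebyshev.S ℂ (k : ℤ)).degree
          < (X * Chebyshev.S ℂ ((k + 1 : ℕ) : ℤ)).degree := by
        apply degree_lt_degree
        omega
      rw [e]
      refine ⟨hm.sub_of_left hd, ?_⟩
      rw [natDegree_sub_eq_left_of_natDegree_lt (by omega), hn]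

theorem zpow_sub_zpow_neg_eq_eval_chebyshevS {z : ℂ} (hz : z ≠ 0) (k : ℕ) :
    z ^ ((k + 1 : ℕ) : ℤ) - z ^ (-((k + 1 : ℕ) : ℤ))
      = (z - z⁻¹) * (Chebyshev.S ℂ k).eval (z + z⁻¹) := by
  induction k using Nat.strong_induction_on with
  | _ k ih =>
    match k, ih with
    | 0, _ => simp
    | 1, _ =>
      simp only [zpow_neg, zpow_natCast, Nat.cast_one, Chebyshev.S_one, eval_X]
      field_simp
      ring
    | k + 2, ih =>
      have h0 := ih k (by omega)
      have h1 := ih (k + 1) (by omega)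
      have e : Chebyshev.S ℂ ((k + 2 : ℕ) : ℤ)
          = X * Chebyshev.S ℂ ((k + 1 : ℕ) : ℤ) - Chebyshev.S ℂ (k : ℤ) := by
        push_cast
        exact Chebyshev.S_add_two ℂ k
      rw [e, eval_sub, eval_mul, eval_X, mul_sub, mul_left_comm, ← h0, ← h1]
      simp only [zpow_neg, zpow_natCast]
      field_simp
      ring

theorem sdet_deltaE_eq (N : ℕ) (z : Fin N → ℂ) (hz : ∀ i, z i ≠ 0) :
    sdet N (deltaE N) z = (∏ i : Fin N, (z i.rev - (z i.rev)⁻¹)) *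
      (Matrix.vandermonde fun i : Fin N => z i.rev + (z i.rev)⁻¹).det := by
  rw [Matrix.det_eval_matrixOfPolynomials_eq_det_vandermonde _
    (fun i : Fin N => Chebyshev.S ℂ ((i : ℕ) : ℤ))
    (fun i => (chebyshevS_monic_natDegree i).2) (fun i => (chebyshevS_monic_natDegree i).1),
    ← Matrix.det_transpose, ← Matrix.det_mul_row, sdet,
    ← Matrix.det_submatrix_equiv_self Fin.revPerm]
  congr 1
  ext i j
  have hi : deltaE N i.rev = (i : ℕ) + 1 := by
    simp only [deltaE, Fin.val_rev]
    omega
  simp only [Matrix.submatrix_apply, Fin.revPerm_apply, Matrix.of_apply, hi,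
    Matrix.transpose_apply]
  exact zpow_sub_zpow_neg_eq_eval_chebyshevS (hz _) i

/-- The point `(a_0, …, a_{m-1}, z)`. -/
def snocPoint (m : ℕ) (a : ℕ → ℂ) (z : ℂ) : Fin (m + 1) → ℂ :=
  fun i => if i.1 < m then a i.1 else z

/-- The last-variable factor of the symplectic Weyl denominator. -/
def weylFactor (m : ℕ) (a : ℕ → ℂ) (z : ℂ) : ℂ :=
  (z - z⁻¹) * ∏ j ∈ Finset.range m, (a j + (a j)⁻¹ - (z + z⁻¹))

theorem snocPoint_ne_zero {m : ℕ} {a : ℕ → ℂ} {z : ℂ} (ha : ∀ i, a i ≠ 0) (hz : z ≠ 0)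
    (i : Fin (m + 1)) : snocPoint m a z i ≠ 0 := by
  unfold snocPoint
  split_ifs
  exacts [ha _, hz]

theorem sdet_deltaE_snocPoint (m : ℕ) (a : ℕ → ℂ) (ha : ∀ i, a i ≠ 0)
    (hsq : ∀ i, a i - (a i)⁻¹ ≠ 0) (hinj : Function.Injective fun i => a i + (a i)⁻¹) :
    ∃ C : ℂ, C ≠ 0 ∧ ∀ z, z ≠ 0 →
      sdet (m + 1) (deltaE (m + 1)) (snocPoint m a z) = C * weylFactor m a z := by
  have h0 : ∀ z, snocPoint m a z (Fin.rev 0) = z := by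
    intro z
    simp [snocPoint]
  have hs : ∀ z (i : Fin m), snocPoint m a z (Fin.rev i.succ) = a i.rev := by
    intro z i
    have h1 : (Fin.rev i.succ).1 = (i.rev).1 := by
      simp only [Fin.val_rev, Fin.val_succ]
      omega
    simp only [snocPoint, h1, i.rev.2, if_true]
  refine ⟨(∏ i : Fin m, (a i.rev - (a i.rev)⁻¹)) *
    (Matrix.vandermonde fun i : Fin m => a i.rev + (a i.rev)⁻¹).det, ?_, ?_⟩
  · refine mul_ne_zero (Finset.prod_ne_zero_iff.2 fun i _ => hsq _) ?_
    rw [Matrix.det_vandermonde_ne_zero_iff]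
    intro i j hij
    have := hinj hij
    exact Fin.rev_injective (Fin.ext this)
  · intro z hz
    rw [sdet_deltaE_eq _ _ (snocPoint_ne_zero ha hz), Matrix.det_vandermonde,
      Matrix.det_vandermonde, Fin.prod_univ_succ, Fin.prod_univ_succ]
    simp only [Fin.prod_Ioi_zero, Fin.prod_Ioi_succ, h0, hs]
    have hrev : ∏ j : Fin m, (a j.rev + (a j.rev)⁻¹ - (z + z⁻¹))
        = ∏ j ∈ Finset.range m, (a j + (a j)⁻¹ - (z + z⁻¹)) := by
      rw [Finset.prod_range]
      exact Equiv.prod_comp Fin.revPerm (fun j : Fin m => a j + (a j)⁻¹ - (z + z⁻¹))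
    rw [hrev, weylFactor]
    ring

theorem sdet_snocPoint_eq_sum (m : ℕ) (e : Fin (m + 1) → ℕ) (a : ℕ → ℂ) :
    ∃ c : Fin (m + 1) → ℂ, ∀ z,
      sdet (m + 1) e (snocPoint m a z) = ∑ i, c i * (z ^ (e i : ℤ) - z ^ (-(e i : ℤ))) := by
  set A : Matrix (Fin (m + 1)) (Fin (m + 1)) ℂ := Matrix.of fun i j =>
    snocPoint m a 1 j ^ (e i : ℤ) - snocPoint m a 1 j ^ (-(e i : ℤ)) with hA
  refine ⟨fun i => A.adjugate (Fin.last m) i, fun z => ?_⟩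
  have h := congrFun (Matrix.cramer_eq_adjugate_mulVec A
    (fun i => z ^ (e i : ℤ) - z ^ (-(e i : ℤ)))) (Fin.last m)
  rw [Matrix.cramer_apply] at h
  rw [sdet]
  refine Eq.trans ?_ h
  congr 1
  ext i j
  rw [Matrix.updateCol_apply]
  by_cases hj : j = Fin.last m
  · simp [hj, snocPoint]
  · have : j.1 < m := Fin.val_lt_last hj
    simp [hj, hA, snocPoint, this]

/-- The operator `z d/dz - M` on polynomials. -/
def shiftedEuler (M : ℕ) (P : ℂ[X]) : ℂ[X] := X * derivative P - C (M : ℂ) * P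

theorem coeff_shiftedEuler (M : ℕ) (P : ℂ[X]) (e : ℕ) :
    (shiftedEuler M P).coeff e = ((e : ℂ) - M) * P.coeff e := by
  rw [shiftedEuler, coeff_sub, coeff_C_mul]
  cases e with
  | zero => simp
  | succ e =>
    rw [coeff_X_mul, coeff_derivative]
    push_cast
    ring

theorem pow_sub_one_dvd_shiftedEuler {M k : ℕ} {P Q : ℂ[X]} (h : Q ^ k ∣ P) :
    Q ^ (k - 1) ∣ shiftedEuler M P :=
  dvd_sub ((pow_sub_one_dvd_derivative_of_pow_dvd h).mul_left _)
    (((pow_dvd_pow _ (Nat.sub_le _ _)).trans h).mul_left _)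

/-- A polynomial with at most `s.card` terms that vanishes to order `s.card` at `1` is zero. -/
theorem eq_zero_of_support_subset_of_pow_dvd (s : Finset ℕ) :
    ∀ P : ℂ[X], P.support ⊆ s → (X - C 1) ^ s.card ∣ P → P = 0 := by
  induction s using Finset.induction_on with
  | empty =>
    intro P hP _
    simpa using hP
  | insert k s hk ih =>
    intro P hP hd
    rw [Finset.card_insert_of_notMem hk] at hd
    have hQ : shiftedEuler k P = 0 := by
      apply ih
      · intro e he
        rw [mem_support_iff, coeff_shiftedEuler] at he
        have h1 := hP (mem_support_iff.2 (right_ne_zero_of_mul he))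
        rcases Finset.mem_insert.1 h1 with h | h
        · simp [h] at he
        · exact h
      · have hd' := pow_sub_one_dvd_shiftedEuler (M := k) hd
        rwa [Nat.add_sub_cancel] at hd'
    have hmono : P = monomial k (P.coeff k) := by
      ext e
      rw [coeff_monomial]
      split_ifs with h
      · rw [h]
      · have h2 := coeff_shiftedEuler k P e
        rw [hQ, coeff_zero] at h2
        rcases mul_eq_zero.1 h2.symm with h3 | h3
        · exact absurd (by exact_mod_cast (sub_eq_zero.1 h3).symm) h
        · exact h3
    have h1 : P.eval 1 = 0 := by
      have : (X - C (1 : ℂ)) ∣ P := (dvd_pow_self _ (Nat.succ_ne_zero _)).trans hd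
      exact dvd_iff_isRoot.1 this
    rw [hmono, eval_monomial] at h1
    simp only [one_pow, mul_one] at h1
    rw [hmono, h1, monomial_zero_right]

theorem pow_dvd_of_eventually_eq_mul {P : ℂ[X]} {k : ℕ} {f : ℂ → ℂ} (hf : ContinuousAt f 1)
    (h : ∀ᶠ z in 𝓝 (1 : ℂ), P.eval z = (z - 1) ^ k * f z) : (X - C (1 : ℂ)) ^ k ∣ P := by
  by_cases hP : P = 0
  · simp [hP]
  obtain ⟨q, hq, hnd⟩ := exists_eq_pow_rootMultiplicity_mul_and_not_dvd P hP 1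
  set r := rootMultiplicity 1 P
  by_cases hr : k ≤ r
  · rw [hq]
    exact (pow_dvd_pow _ hr).mul_right _
  exfalso
  push Not at hr
  apply hnd
  rw [dvd_iff_isRoot, IsRoot.def]
  have hev : ∀ᶠ z in 𝓝[≠] (1 : ℂ), q.eval z = (z - 1) ^ (k - r) * f z := by
    filter_upwards [h.filter_mono nhdsWithin_le_nhds, self_mem_nhdsWithin] with z hz hz1
    rw [hq] at hz
    have h1 : (z - 1) ^ r ≠ 0 := pow_ne_zero _ (sub_ne_zero.2 hz1)
    apply mul_left_cancel₀ h1
    rw [← mul_assoc, ← pow_add, Nat.add_sub_cancel' hr.le, ← hz]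
    simp
  have l1 : Tendsto (fun z => q.eval z) (𝓝[≠] (1 : ℂ)) (𝓝 (q.eval 1)) :=
    q.continuous.continuousAt.tendsto.mono_left nhdsWithin_le_nhds
  have l2 : Tendsto (fun z => (z - 1) ^ (k - r) * f z) (𝓝[≠] (1 : ℂ))
      (𝓝 ((1 - 1) ^ (k - r) * f 1)) := by
    have : ContinuousAt (fun z : ℂ => (z - 1) ^ (k - r) * f z) 1 := by fun_prop
    exact this.tendsto.mono_left nhdsWithin_le_nhds
  have := tendsto_nhds_unique (l1.congr' hev) l2
  rw [this, sub_self, zero_pow (by omega), zero_mul]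

theorem hasDerivAt_of_eq_eval_div_pow {f : ℂ → ℂ} {M : ℕ} {P : ℂ[X]}
    (hf : ∀ z, z ≠ 0 → f z = P.eval z / z ^ M) {z : ℂ} (hz : z ≠ 0) :
    HasDerivAt f ((shiftedEuler M P).eval z / z ^ M / z) z := by
  have h1 : HasDerivAt (fun w => P.eval w / w ^ M) _ z :=
    (P.hasDerivAt z).div (hasDerivAt_pow M z) (pow_ne_zero _ hz)
  have h2 : f =ᶠ[𝓝 z] fun w => P.eval w / w ^ M := by
    filter_upwards [isOpen_ne.mem_nhds hz] with w hw using hf w hw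
  refine (h1.congr_of_eventuallyEq h2).congr_deriv ?_
  simp only [shiftedEuler, eval_sub, eval_mul, eval_X, eval_C]
  cases M with
  | zero => simp; field_simp
  | succ M =>
    simp only [Nat.add_sub_cancel]
    field_simp
    ring

theorem euler_ode_polynomial (n : ℕ) (P : ℂ[X])
    (hP : ∀ e, P.coeff e ≠ 0 → e ≤ 6 * n + 2 ∧ e % 3 ≠ 1)
    (hd : (X - C (1 : ℂ)) ^ (4 * n + 1) ∣ P) :
    (1 - X ^ 3) * (shiftedEuler (3 * n + 1) (shiftedEuler (3 * n + 1) P)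
        + C ((3 * (n : ℂ) + 1) * (3 * n - 1)) * P)
      + (1 + X ^ 3) * (C (6 * (n : ℂ)) * shiftedEuler (3 * n + 1) P) = 0 := by
  set M := 3 * n + 1 with hM
  set s : Finset ℕ := (Finset.range (4 * n)).image fun j => 3 + 3 * (j / 2) + 2 * (j % 2)
    with hs
  have hcard : s.card ≤ 4 * n := by
    simpa using Finset.card_image_le (s := Finset.range (4 * n))
      (f := fun j => 3 + 3 * (j / 2) + 2 * (j % 2))
  apply eq_zero_of_support_subset_of_pow_dvd s
  · intro e he
    rw [mem_support_iff] at he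
    by_contra hes
    apply he
    have hes' : e < 3 ∨ 6 * n + 2 < e ∨ e % 3 = 1 := by
      by_contra! hcon
      apply hes
      rw [hs, Finset.mem_image]
      refine ⟨2 * ((e - 3) / 3) + (e % 3) / 2, Finset.mem_range.2 ?_, ?_⟩ <;> omega
    have hz : ∀ e, ¬ (e ≤ 6 * n + 2 ∧ e % 3 ≠ 1) → P.coeff e = 0 := fun e h =>
      not_not.1 (mt (hP e) h)
    have key1 : (((e : ℂ) - M) * ((e : ℂ) - M) + (3 * (n : ℂ) + 1) * (3 * n - 1)
        + 6 * n * ((e : ℂ) - M)) * P.coeff e = 0 := by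
      by_cases hc : e ≤ 6 * n + 2 ∧ e % 3 ≠ 1
      · have : e = 0 ∨ e = 2 := by omega
        rcases this with rfl | rfl <;> · rw [hM]; push_cast; ring
      · rw [hz e hc, mul_zero]
    have key2 : 3 ≤ e → (-(((e - 3 : ℕ) : ℂ) - M) * (((e - 3 : ℕ) : ℂ) - M)
        - (3 * (n : ℂ) + 1) * (3 * n - 1)
        + 6 * n * (((e - 3 : ℕ) : ℂ) - M)) * P.coeff (e - 3) = 0 := by
      intro h3
      by_cases hc : e - 3 ≤ 6 * n + 2 ∧ (e - 3) % 3 ≠ 1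
      · have : e - 3 = 6 * n ∨ e - 3 = 6 * n + 2 := by omega
        rcases this with h | h <;> · rw [h, hM]; push_cast; ring
      · rw [hz _ hc, mul_zero]
    simp only [sub_mul, add_mul, one_mul, coeff_add, coeff_sub, coeff_X_pow_mul', coeff_C_mul,
      coeff_shiftedEuler]
    split_ifs with h3
    · linear_combination key1 + key2 h3
    · linear_combination key1
  · have h1 : (X - C (1 : ℂ)) ^ (4 * n) ∣ shiftedEuler M P := by
      have hd' := pow_sub_one_dvd_shiftedEuler (M := M) hd
      rwa [Nat.add_sub_cancel] at hd'
    have h2 : (X - C (1 : ℂ)) ^ (4 * n - 1) ∣ shiftedEuler M (shiftedEuler M P) :=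
      pow_sub_one_dvd_shiftedEuler h1
    have h3 : (X - C (1 : ℂ)) ∣ 1 - X ^ 3 := by
      rw [dvd_iff_isRoot, IsRoot.def]
      simp
    refine (pow_dvd_pow _ hcard).trans (dvd_add ?_ ((h1.mul_left _).mul_left _))
    rw [mul_add]
    refine dvd_add ?_ ((((pow_dvd_pow _ (Nat.le_succ _)).trans hd).mul_left _).mul_left _)
    refine (pow_dvd_pow _ (by omega : 4 * n ≤ 1 + (4 * n - 1))).trans ?_
    rw [pow_add, pow_one]
    exact mul_dvd_mul h3 h2

theorem exists_polynomial_of_tendsto_span (T : Finset ℕ) (M : ℕ) (S : Set ℂ) (F : ℕ → S → ℂ)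
    (G : S → ℂ)
    (hF : ∀ m, F m ∈ Submodule.span ℂ
      (Set.range fun (e : T) (z : S) => (z : ℂ) ^ (e : ℕ) / (z : ℂ) ^ M))
    (hlim : Tendsto F atTop (𝓝 G)) :
    ∃ P : ℂ[X], P.support ⊆ T ∧ ∀ z : S, G z = P.eval (z : ℂ) / (z : ℂ) ^ M := by
  set V := Submodule.span ℂ
      (Set.range fun (e : T) (z : S) => (z : ℂ) ^ (e : ℕ) / (z : ℂ) ^ M)
  have : FiniteDimensional ℂ V := FiniteDimensional.span_of_finite ℂ (Set.finite_range _)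
  have hG : G ∈ V := V.closed_of_finiteDimensional.mem_of_tendsto hlim (.of_forall hF)
  obtain ⟨c, hc⟩ := (Submodule.mem_span_range_iff_exists_fun ℂ).1 hG
  refine ⟨∑ e : T, monomial (e : ℕ) (c e), ?_, fun z => ?_⟩
  · intro e he
    rw [mem_support_iff, finsetSum_coeff] at he
    obtain ⟨i, -, hi⟩ := Finset.exists_ne_zero_of_sum_ne_zero he
    rw [coeff_monomial] at hi
    have : (i : ℕ) = e := by
      by_contra h
      simp [h] at hi
    exact this ▸ i.2
  · rw [← hc, eval_finsetSum, Finset.sum_apply, Finset.sum_div]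
    simp [mul_div_assoc]

theorem sdet_muE_snocPoint_mem_span (n : ℕ) (a : ℕ → ℂ) (C : ℂ) (S : Set ℂ)
    (hS : ∀ z ∈ S, z ≠ 0) :
    (fun z : S => sdet (2 * n + 1) (muE (2 * n + 1)) (snocPoint (2 * n) a z) / C) ∈
      Submodule.span ℂ (Set.range
        fun (e : (Finset.range (6 * n + 3)).filter fun e => e % 3 ≠ 1) (z : S) =>
          (z : ℂ) ^ (e : ℕ) / (z : ℂ) ^ (3 * n + 1)) := by
  obtain ⟨c, hc⟩ := sdet_snocPoint_eq_sum (2 * n) (muE (2 * n + 1)) a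
  have hmem : ∀ e : ℕ, e < 6 * n + 3 → e % 3 ≠ 1 →
      (fun z : S => (z : ℂ) ^ e / (z : ℂ) ^ (3 * n + 1)) ∈ Submodule.span ℂ (Set.range
        fun (e : (Finset.range (6 * n + 3)).filter fun e => e % 3 ≠ 1) (z : S) =>
          (z : ℂ) ^ (e : ℕ) / (z : ℂ) ^ (3 * n + 1)) := fun e h1 h2 =>
    Submodule.subset_span ⟨⟨e, Finset.mem_filter.2 ⟨Finset.mem_range.2 h1, h2⟩⟩, rfl⟩
  have hμ : ∀ i : Fin (2 * n + 1),
      muE (2 * n + 1) i ≤ 3 * n + 1 ∧ muE (2 * n + 1) i % 3 ≠ 0 := by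
    intro i
    have := i.2
    unfold muE
    omega
  have heq : (fun z : S => sdet (2 * n + 1) (muE (2 * n + 1)) (snocPoint (2 * n) a z) / C)
      = ∑ i, (c i / C) • ((fun z : S => (z : ℂ) ^ (3 * n + 1 + muE (2 * n + 1) i)
            / (z : ℂ) ^ (3 * n + 1))
          - fun z : S => (z : ℂ) ^ (3 * n + 1 - muE (2 * n + 1) i) / (z : ℂ) ^ (3 * n + 1)) := by
    ext z
    have hz := hS z z.2
    rw [hc, Finset.sum_apply, Finset.sum_div]
    refine Finset.sum_congr rfl fun i _ => ?_
    simp only [Pi.smul_apply, Pi.sub_apply, smul_eq_mul]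
    rw [pow_add, mul_div_cancel_left₀ _ (pow_ne_zero _ hz), pow_sub₀ _ hz (hμ i).1,
      mul_div_cancel_left₀ _ (pow_ne_zero _ hz), zpow_neg, zpow_natCast]
    ring
  rw [heq]
  refine Submodule.sum_mem _ fun i _ => Submodule.smul_mem _ _ (Submodule.sub_mem _ ?_ ?_)
  · apply hmem <;> have := hμ i <;> omega
  · apply hmem <;> have := hμ i <;> omega

theorem weylFactor_one_eq (n : ℕ) {z : ℂ} (hz : z ≠ 0) :
    weylFactor (2 * n) (fun _ => 1) z
      = z ^ (-(2 * (n : ℤ) + 1)) * (z - 1) ^ (4 * n + 1) * (z + 1) := by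
  have h1 : (1 : ℂ) + 1⁻¹ - (z + z⁻¹) = -((z - 1) ^ 2 / z) := by
    field_simp
    ring
  have h2 : z ^ (-(2 * (n : ℤ) + 1)) = (z ^ (2 * n + 1))⁻¹ := by
    rw [zpow_neg]
    exact_mod_cast rfl
  rw [weylFactor, Finset.prod_const, Finset.card_range, h1, (even_two_mul n).neg_pow, h2,
    div_pow, ← pow_mul, show 2 * (2 * n) = 4 * n by ring]
  field_simp
  ring

/-- A sequence of generic points converging to `(1, 1, …)`. -/
def genericSeq (m i : ℕ) : ℂ := ((1 + (i + 1) * (1 / ((m : ℝ) + 1)) : ℝ) : ℂ)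

theorem tendsto_genericSeq (i : ℕ) : Tendsto (fun m => genericSeq m i) atTop (𝓝 1) := by
  have h : Tendsto (fun m : ℕ => (1 + (i + 1) * (1 / ((m : ℝ) + 1)) : ℝ)) atTop
      (𝓝 (1 + (i + 1) * 0)) :=
    (tendsto_one_div_add_atTop_nhds_zero_nat.const_mul _).const_add _
  have := (Complex.continuous_ofReal.tendsto _).comp h
  simpa [Function.comp_def, genericSeq] using this

theorem genericSeq_generic (m : ℕ) : (∀ i, genericSeq m i ≠ 0) ∧
    (∀ i, genericSeq m i - (genericSeq m i)⁻¹ ≠ 0) ∧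
    Function.Injective fun i => genericSeq m i + (genericSeq m i)⁻¹ := by
  have ht : (0 : ℝ) < 1 / ((m : ℝ) + 1) := by positivity
  have hx : ∀ i : ℕ, 1 < 1 + ((i : ℝ) + 1) * (1 / ((m : ℝ) + 1)) := fun i => by
    have : 0 < ((i : ℝ) + 1) * (1 / ((m : ℝ) + 1)) := by positivity
    linarith
  refine ⟨fun i => ?_, fun i => ?_, fun i j hij => ?_⟩
  · rw [genericSeq, Complex.ofReal_ne_zero]
    linarith [hx i]
  · rw [genericSeq, ← Complex.ofReal_inv, ← Complex.ofReal_sub, Complex.ofReal_ne_zero]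
    have := inv_lt_one_of_one_lt₀ (hx i)
    linarith [hx i]
  · simp only [genericSeq] at hij
    rw [← Complex.ofReal_inv, ← Complex.ofReal_inv, ← Complex.ofReal_add, ← Complex.ofReal_add,
      Complex.ofReal_inj] at hij
    have hi := hx i
    have hj := hx j
    have hxy : 1 + ((i : ℝ) + 1) * (1 / ((m : ℝ) + 1))
        = 1 + ((j : ℝ) + 1) * (1 / ((m : ℝ) + 1)) := by
      generalize 1 + ((i : ℝ) + 1) * (1 / ((m : ℝ) + 1)) = x at *
      generalize 1 + ((j : ℝ) + 1) * (1 / ((m : ℝ) + 1)) = y at *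
      have h0 : (x - y) * (x * y - 1) = 0 := by
        field_simp at hij
        linear_combination hij
      rcases mul_eq_zero.1 h0 with h | h
      · linarith
      · nlinarith
    have := mul_right_cancel₀ ht.ne' (add_left_cancel hxy)
    exact_mod_cast add_right_cancel this

theorem tendsto_snocPoint (k : ℕ) (z : ℂ) :
    Tendsto (fun m => snocPoint k (genericSeq m) z) atTop (𝓝 (snocPoint k (fun _ => 1) z)) := by
  rw [tendsto_pi_nhds]
  intro i
  unfold snocPoint
  split_ifs
  exacts [tendsto_genericSeq _, tendsto_const_nhds]

theorem tendsto_weylFactor (k : ℕ) (z : ℂ) :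
    Tendsto (fun m => weylFactor k (genericSeq m) z) atTop
      (𝓝 (weylFactor k (fun _ => 1) z)) := by
  refine (tendsto_finsetProd _ fun i _ => ?_).const_mul _
  exact ((tendsto_genericSeq i).add ((tendsto_genericSeq i).inv₀ one_ne_zero)).sub_const _

theorem isOpen_forall_ne_zero (k : ℕ) : IsOpen {z : Fin k → ℂ | ∀ i, z i ≠ 0} := by
  simp only [Set.ofPred_forall]
  exact isOpen_iInter_of_finite fun i => isOpen_ne.preimage (continuous_apply i)

theorem exists_polynomial_eq_weylFactor_mul (n : ℕ) (X : (Fin (2 * n + 1) → ℂ) → ℂ)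
    (hX : IsSymplecticExt (2 * n + 1) X) :
    ∃ P : ℂ[X], (∀ e, P.coeff e ≠ 0 → e ≤ 6 * n + 2 ∧ e % 3 ≠ 1) ∧
      ∀ z, z ≠ 0 → z ≠ 1 → z ≠ -1 →
        weylFactor (2 * n) (fun _ => 1) z * X (snocPoint (2 * n) (fun _ => 1) z)
          = P.eval z / z ^ (3 * n + 1) := by
  choose C hC0 hC using fun m => sdet_deltaE_snocPoint (2 * n) (genericSeq m)
    (genericSeq_generic m).1 (genericSeq_generic m).2.1 (genericSeq_generic m).2.2
  set S : Set ℂ := {z | z ≠ 0 ∧ z ≠ 1 ∧ z ≠ -1} with hS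
  have hlim : Tendsto (fun m (z : S) => sdet (2 * n + 1) (muE (2 * n + 1))
      (snocPoint (2 * n) (genericSeq m) z) / C m) atTop
      (𝓝 fun z : S => weylFactor (2 * n) (fun _ => 1) z
        * X (snocPoint (2 * n) (fun _ => 1) z)) := by
    rw [tendsto_pi_nhds]
    rintro ⟨z, hz, hz1, hz2⟩
    have hw : weylFactor (2 * n) (fun _ => 1) z ≠ 0 := by
      rw [weylFactor_one_eq n hz]
      exact mul_ne_zero (mul_ne_zero (zpow_ne_zero _ hz) (pow_ne_zero _ (sub_ne_zero.2 hz1)))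
        (fun h => hz2 (eq_neg_of_add_eq_zero_left h))
    have hcont : ContinuousAt X (snocPoint (2 * n) (fun _ => 1) z) :=
      hX.1.continuousAt ((isOpen_forall_ne_zero _).mem_nhds
        (snocPoint_ne_zero (fun _ => one_ne_zero) hz))
    refine ((tendsto_weylFactor (2 * n) z).mul
      (hcont.tendsto.comp (tendsto_snocPoint (2 * n) z))).congr' ?_
    filter_upwards [(tendsto_weylFactor (2 * n) z).eventually_ne hw] with m hm
    have hd : sdet (2 * n + 1) (deltaE (2 * n + 1)) (snocPoint (2 * n) (genericSeq m) z) ≠ 0 := by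
      rw [hC m z hz]
      exact mul_ne_zero (hC0 m) hm
    have hC0m := hC0 m
    simp only [Function.comp_apply]
    rw [hX.2 _ (snocPoint_ne_zero (genericSeq_generic m).1 hz) hd, hC m z hz]
    field_simp
  obtain ⟨P, hPT, hP⟩ := exists_polynomial_of_tendsto_span _ _ S _ _
    (fun m => sdet_muE_snocPoint_mem_span n (genericSeq m) (C m) S fun z hz => hz.1) hlim
  refine ⟨P, fun e he => ?_, fun z h0 h1 h2 => hP ⟨z, h0, h1, h2⟩⟩
  have := hPT (mem_support_iff.2 he)
  rw [Finset.mem_filter, Finset.mem_range] at this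
  exact ⟨by omega, this.2⟩

theorem continuousAt_comp_snocPoint (n : ℕ) (X : (Fin (2 * n + 1) → ℂ) → ℂ)
    (hX : IsSymplecticExt (2 * n + 1) X) {z : ℂ} (hz : z ≠ 0) :
    ContinuousAt (fun w => X (snocPoint (2 * n) (fun _ => 1) w)) z := by
  have hcont : ContinuousAt X (snocPoint (2 * n) (fun _ => 1) z) :=
    hX.1.continuousAt ((isOpen_forall_ne_zero _).mem_nhds
      (snocPoint_ne_zero (fun _ => one_ne_zero) hz))
  refine ContinuousAt.comp (g := X) hcont (continuousAt_pi.2 fun i => ?_)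
  unfold snocPoint
  split_ifs
  exacts [continuousAt_const, continuousAt_id]
/-- **Proposition 4.3 (odd size).** The function
`g(z) = z^{−(2n+1)} (z−1)^{4n+1} (z+1) χ_{2n+1}(1,…,1,z)` is twice differentiable
away from `0` and satisfies the ODE
`z (z g′)′ + 6n (1+z³)/(1−z³) z g′ + (3n+1)(3n−1) g = 0` for `z³ ≠ 1`. -/
theorem ode_odd (n : ℕ)
    (X : (Fin (2*n+1) → ℂ) → ℂ) (hX : IsSymplecticExt (2*n+1) X)
    (g : ℂ → ℂ)
    (hg : ∀ z : ℂ, g z = z ^ (-(2*(n:ℤ)+1)) * (z-1)^(4*n+1) * (z+1) *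
        X (fun i => if i.1 < 2*n then 1 else z)) :
    (∀ z : ℂ, z ≠ 0 → DifferentiableAt ℂ g z ∧ DifferentiableAt ℂ (deriv g) z)
    ∧ ∀ z : ℂ, z ≠ 0 → z^3 ≠ 1 →
        z * deriv (fun w => w * deriv g w) z
        + 6*(n:ℂ) * ((1 + z^3)/(1 - z^3)) * (z * deriv g z)
        + (3*(n:ℂ) + 1) * (3*(n:ℂ) - 1) * g z = 0 := by
  obtain ⟨P, hPc, hP⟩ := exists_polynomial_eq_weylFactor_mul n X hX
  set f : ℂ → ℂ := fun z => X (snocPoint (2 * n) (fun _ => 1) z) with hf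
  have hfc : ∀ z, z ≠ 0 → ContinuousAt f z := fun z hz =>
    continuousAt_comp_snocPoint n X hX hz
  have hgf : ∀ z, g z = z ^ (-(2*(n:ℤ)+1)) * (z-1)^(4*n+1) * (z+1) * f z := fun z => hg z
  have hg0 : ∀ z, z ≠ 0 → g z = P.eval z / z ^ (3 * n + 1) := by
    intro z hz
    have hev : ∀ᶠ w in 𝓝[≠] z, g w = P.eval w / w ^ (3 * n + 1) := by
      have hfin : ∀ᶠ w in 𝓝[≠] z, w ∉ (({0, 1, -1} : Set ℂ) \ {z}) :=
        (((Set.toFinite _).isClosed.isOpen_compl.mem_nhds (by simp)) :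
          (({0, 1, -1} : Set ℂ) \ {z})ᶜ ∈ 𝓝 z) |> mem_nhdsWithin_of_mem_nhds
      filter_upwards [hfin, self_mem_nhdsWithin] with w hw hwz
      have hw' : w ∉ ({0, 1, -1} : Set ℂ) := fun h => hw ⟨h, hwz⟩
      simp only [Set.mem_insert_iff, Set.mem_singleton_iff, not_or] at hw'
      rw [hgf, ← weylFactor_one_eq n hw'.1]
      exact hP w hw'.1 hw'.2.1 hw'.2.2
    have c1 : ContinuousAt g z := by
      have : ContinuousAt
          (fun z => z ^ (-(2*(n:ℤ)+1)) * (z-1)^(4*n+1) * (z+1) * f z) z :=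
        ((((continuousAt_zpow₀ z _ (Or.inl hz)).mul (by fun_prop)).mul (by fun_prop)).mul
          (hfc z hz))
      exact (funext hgf : g = _) ▸ this
    have c2 : ContinuousAt (fun w => P.eval w / w ^ (3 * n + 1)) z :=
      P.continuous.continuousAt.div (by fun_prop) (pow_ne_zero _ hz)
    exact tendsto_nhds_unique ((c1.tendsto.mono_left nhdsWithin_le_nhds).congr' hev)
      (c2.tendsto.mono_left nhdsWithin_le_nhds)
  have hdvd : (Polynomial.X - C (1 : ℂ)) ^ (4 * n + 1) ∣ P := by
    refine pow_dvd_of_eventually_eq_mul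
      (f := fun z => z ^ (3 * n + 1) * z ^ (-(2*(n:ℤ)+1)) * (z + 1) * f z) ?_ ?_
    · exact ((((by fun_prop : ContinuousAt (fun z : ℂ => z ^ (3 * n + 1)) 1)).mul
        (continuousAt_zpow₀ 1 _ (Or.inl one_ne_zero))).mul (by fun_prop)).mul
          (hfc 1 one_ne_zero)
    · filter_upwards [isOpen_ne.mem_nhds (one_ne_zero (α := ℂ))] with z hz
      have h := hg0 z hz
      rw [eq_div_iff (pow_ne_zero _ hz), hgf] at h
      rw [← h]
      ring
  set M := 3 * n + 1 with hM
  set Q := shiftedEuler M P with hQ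
  have d1 : ∀ z, z ≠ 0 → HasDerivAt g (Q.eval z / z ^ M / z) z := fun z hz =>
    hasDerivAt_of_eq_eval_div_pow hg0 hz
  have e1 : ∀ z, z ≠ 0 → z * deriv g z = Q.eval z / z ^ M := by
    intro z hz
    rw [(d1 z hz).deriv]
    field_simp
  have e2 : ∀ z, z ≠ 0 → deriv g z = Q.eval z / z ^ (M + 1) := by
    intro z hz
    rw [(d1 z hz).deriv, div_div, ← pow_succ]
  refine ⟨fun z hz => ⟨(d1 z hz).differentiableAt,
    (hasDerivAt_of_eq_eval_div_pow e2 hz).differentiableAt⟩, fun z hz hz3 => ?_⟩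
  have key := congrArg (eval z) (euler_ode_polynomial n P hPc hdvd)
  simp only [eval_add, eval_mul, eval_sub, eval_pow, eval_X, eval_C, eval_one, eval_zero,
    ← hM, ← hQ] at key
  rw [(hasDerivAt_of_eq_eval_div_pow e1 hz).deriv, e1 z hz, hg0 z hz]
  have hz3' : 1 - z ^ 3 ≠ 0 := sub_ne_zero.2 (Ne.symm hz3)
  field_simp
  linear_combination key

end
end

section
/- For integers N1 even and N2 odd, N1, N2 ≥ 2, with N = N1 + N2 and ξ = N1/N, define G(N1, N2) = −ln( γ_{N1} γ_{N2} γ_{N+1} / ( γ_{N1+1} γ_{N2+1} γ_N ) ), and let K = (8/(3Γ(1/3)))·√(π/3). Then for every δ ∈ (0, 1/2) there exist C > 0 and N₀ such that for all such N1, N2 with N ≥ N₀ and δ ≤ ξ ≤ 1−δ, one has | G(N1, N2) − [ (1/6)·ln N + (1/6)·ln(ξ/(1−ξ)) − ln K + (1/72)·( 13/ξ + 11·(1 − 1/(1−ξ)) )·N^{−1} ] | ≤ C·N^{−2}. -/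
noncomputable section

/-- `γ_N`: `A_V(N+1)` for `N` even, `N_8(N+1)` for `N` odd. -/
def gammaN (N : ℕ) : ℝ :=
  if N % 2 = 0 then
    ((2:ℝ)⁻¹) ^ (N/2) * ∏ i ∈ Finset.Icc 1 (N/2),
      ((Nat.factorial (6*i-2) : ℝ) * (Nat.factorial (2*i-1) : ℝ)) /
        ((Nat.factorial (4*i-2) : ℝ) * (Nat.factorial (4*i-1) : ℝ))
  else
    ∏ i ∈ Finset.range ((N+1)/2),
      (((3*i+1 : ℕ) : ℝ) * (Nat.factorial (6*i) : ℝ) * (Nat.factorial (2*i) : ℝ)) /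
        ((Nat.factorial (4*i) : ℝ) * (Nat.factorial (4*i+1) : ℝ))

/-- The supersymmetric-point LBF `G(N1,N2) = −ln(γ_{N1} γ_{N2} γ_{N+1} /
(γ_{N1+1} γ_{N2+1} γ_N))`. -/
def Gsusy (N1 N2 : ℕ) : ℝ :=
  -Real.log (gammaN N1 * gammaN N2 * gammaN (N1+N2+1) /
    (gammaN (N1+1) * gammaN (N2+1) * gammaN (N1+N2)))

/-- The constant `K = (8/(3Γ(1/3)))·√(π/3)`. -/
def Ksusy : ℝ := 8/(3 * Real.Gamma (1/3)) * Real.sqrt (Real.pi/3)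

/-- A quadratic Taylor estimate for `log (1 + y)` with a cubic remainder. -/
lemma abs_log_one_add_sub_le {y : ℝ} (hy : 0 ≤ y) :
    |Real.log (1 + y) - (y - y ^ 2 / 2)| ≤ y ^ 3 := by
  have hlow : y - y ^ 2 / 2 ≤ Real.log (1 + y) := by
    refine le_trans ?_ (Real.le_log_one_add_of_nonneg hy)
    rw [le_div_iff₀ (by positivity)]
    nlinarith [pow_nonneg hy 3]
  have hup : Real.log (1 + y) ≤ y - y ^ 2 / 2 + y ^ 3 := by
    have h1 : Real.log (1 + y) ≤ Real.sinh (Real.log (1 + y)) :=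
      Real.self_le_sinh_iff.2 (Real.log_nonneg (by linarith))
    rw [Real.sinh_log (by positivity)] at h1
    refine h1.trans ?_
    have h2 : (1 + y - (1 + y)⁻¹) / 2 = (2 * y + y ^ 2) / (2 * (1 + y)) := by
      field_simp
      ring
    rw [h2, div_le_iff₀ (by positivity)]
    nlinarith [pow_nonneg hy 3, pow_nonneg hy 4]
  rw [abs_le]
  constructor <;> linarith [pow_nonneg hy 3]

/-- A sequence whose increments are dominated by those of a sequence decreasing to `0` converges,
with the corresponding error bound. -/
lemma exists_tendsto_of_abs_sub_le {f g : ℕ → ℝ} (hg : Filter.Tendsto g Filter.atTop (nhds 0))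
    (h : ∀ k, |f (k + 1) - f k| ≤ g k - g (k + 1)) :
    ∃ L, Filter.Tendsto f Filter.atTop (nhds L) ∧ ∀ k, |f k - L| ≤ g k := by
  have hg' : Antitone g := antitone_nat_of_succ_le fun k => by
    linarith [h k, abs_nonneg (f (k + 1) - f k)]
  have hg0 : ∀ k, 0 ≤ g k := hg'.le_of_tendsto hg
  have hadd : Antitone fun k => f k + g k := antitone_nat_of_succ_le fun k => by
    linarith [(abs_le.1 (h k)).2]
  have hsub : Monotone fun k => f k - g k := monotone_nat_of_le_succ fun k => by
    linarith [(abs_le.1 (h k)).1]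
  have hbdd : BddAbove (Set.range fun k => f k - g k) := by
    refine ⟨f 0 + g 0, ?_⟩
    rintro _ ⟨k, rfl⟩
    have := hadd (Nat.zero_le k)
    dsimp only at this ⊢
    linarith [hg0 k]
  have hlim := tendsto_atTop_ciSup hsub hbdd
  set L := ⨆ k, (f k - g k)
  have hf : Filter.Tendsto f Filter.atTop (nhds L) := by
    simpa using hlim.add hg
  have hlim' : Filter.Tendsto (fun k => f k + g k) Filter.atTop (nhds L) := by
    simpa using hf.add hg
  refine ⟨L, hf, fun k => ?_⟩
  rw [abs_le]
  constructor
  · linarith [hadd.le_of_tendsto hlim' k]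
  · linarith [hsub.ge_of_tendsto hlim k]

/-- The logarithmic increment `log ((x+a)(x+b)/((x+3/2)(x+5/2)))` agrees with the increment of
`e log x + d / x` up to `O(x⁻³)`, when `e` and `d` match the first two Taylor coefficients. -/
lemma abs_log_increment_le {a b e d x : ℝ} (ha : 0 ≤ a) (hb : 0 ≤ b) (hx : 1 ≤ x)
    (he : a + b - 4 = 2 * e) (hd : a ^ 2 + b ^ 2 - 17 / 2 = 4 * e + 4 * d) :
    |Real.log (x + a) + Real.log (x + b) - Real.log (x + 3 / 2) - Real.log (x + 5 / 2)
      - (e * Real.log (x + 2) + d / (x + 2) - (e * Real.log x + d / x))|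
      ≤ (a ^ 3 + b ^ 3 + 19 + 8 * |e| + 4 * |d|) / x ^ 3 := by
  have hx0 : 0 < x := by linarith
  have key : ∀ c : ℝ, 0 ≤ c → ∃ r, |r| ≤ c ^ 3 / x ^ 3 ∧
      Real.log (x + c) = Real.log x + c / x - (c / x) ^ 2 / 2 + r := by
    intro c hc
    refine ⟨Real.log (1 + c / x) - (c / x - (c / x) ^ 2 / 2), ?_, ?_⟩
    · rw [← div_pow]
      exact abs_log_one_add_sub_le (by positivity)
    · have : x + c = x * (1 + c / x) := by field_simp
      rw [this, Real.log_mul hx0.ne' (by positivity)]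
      ring
  obtain ⟨ra, hra, ea⟩ := key a ha
  obtain ⟨rb, hrb, eb⟩ := key b hb
  obtain ⟨r₃, hr₃, e₃⟩ := key (3 / 2) (by norm_num)
  obtain ⟨r₅, hr₅, e₅⟩ := key (5 / 2) (by norm_num)
  obtain ⟨r₂, hr₂, e₂⟩ := key 2 (by norm_num)
  have hd2 : |d * (4 / (x ^ 2 * (x + 2)))| ≤ 4 * |d| / x ^ 3 := by
    rw [abs_mul, abs_of_nonneg (a := 4 / (x ^ 2 * (x + 2))) (by positivity), mul_comm 4, mul_div_assoc]
    gcongr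
    nlinarith [sq_nonneg x]
  have he2 : |e * r₂| ≤ 8 * |e| / x ^ 3 := by
    rw [abs_mul]
    calc |e| * |r₂| ≤ |e| * (2 ^ 3 / x ^ 3) := by gcongr
      _ = _ := by ring
  have main : Real.log (x + a) + Real.log (x + b) - Real.log (x + 3 / 2) - Real.log (x + 5 / 2)
      - (e * Real.log (x + 2) + d / (x + 2) - (e * Real.log x + d / x))
      = ra + rb - r₃ - r₅ - e * r₂ - d * (4 / (x ^ 2 * (x + 2))) := by
    have hd' : d = (a ^ 2 + b ^ 2 - 17 / 2) / 4 - (a + b - 4) / 2 := by linarith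
    have he' : e = (a + b - 4) / 2 := by linarith
    rw [ea, eb, e₃, e₅, e₂, hd', he']
    field_simp
    ring
  rw [main]
  have hsum : (a ^ 3 + b ^ 3 + 19 + 8 * |e| + 4 * |d|) / x ^ 3 = a ^ 3 / x ^ 3 + b ^ 3 / x ^ 3
      + (3 / 2) ^ 3 / x ^ 3 + (5 / 2) ^ 3 / x ^ 3 + 8 * |e| / x ^ 3 + 4 * |d| / x ^ 3 := by ring
  rw [hsum, abs_le]
  rw [abs_le] at hra hrb hr₃ hr₅ hd2 he2
  constructor <;> linarith

lemma log_mul_div_mul {u v s t : ℝ} (hu : 0 < u) (hv : 0 < v) (hs : 0 < s) (ht : 0 < t) :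
    Real.log (u * v / (s * t)) = Real.log u + Real.log v - Real.log s - Real.log t := by
  rw [Real.log_div (by positivity) (by positivity), Real.log_mul hu.ne' hv.ne',
    Real.log_mul hs.ne' ht.ne']
  ring

/-- Asymptotics of a positive sequence with hypergeometric-type ratio. -/
lemma exists_log_asymptotics {p : ℕ → ℝ} (hp : ∀ k, 0 < p k) {a b e d c : ℝ} (ha : 0 ≤ a)
    (hb : 0 ≤ b) (hc : 1 ≤ c)
    (he : a + b - 4 = 2 * e) (hd : a ^ 2 + b ^ 2 - 17 / 2 = 4 * e + 4 * d)
    (hrec : ∀ k : ℕ, p (k + 1) = p k * (27 / 16 * ((2 * k + c + a) * (2 * k + c + b) /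
      ((2 * k + c + 3 / 2) * (2 * k + c + 5 / 2))))) :
    ∃ L C : ℝ, 0 < C ∧
      Filter.Tendsto (fun k : ℕ => Real.log (p k) - ((2 * k + c) / 2 * Real.log (27 / 16)
        + e * Real.log (2 * k + c) + d / (2 * k + c))) Filter.atTop (nhds L) ∧
      ∀ k : ℕ, |Real.log (p k) - ((2 * k + c) / 2 * Real.log (27 / 16)
        + e * Real.log (2 * k + c) + d / (2 * k + c)) - L| ≤ C / (2 * k + c) ^ 2 := by
  set B := a ^ 3 + b ^ 3 + 19 + 8 * |e| + 4 * |d| with hB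
  have hB0 : 0 < B := by positivity
  have htop : Filter.Tendsto (fun k : ℕ => 2 * (k : ℝ) + c) Filter.atTop Filter.atTop :=
    Filter.tendsto_atTop_add_const_right _ _
      (tendsto_natCast_atTop_atTop.const_mul_atTop (by norm_num))
  have hg : Filter.Tendsto (fun k : ℕ => 2 * B / (2 * (k : ℝ) + c) ^ 2) Filter.atTop (nhds 0) :=
    ((Filter.tendsto_pow_atTop (by norm_num)).comp htop).const_div_atTop _
  obtain ⟨L, hL, hbound⟩ := exists_tendsto_of_abs_sub_le hg
    (f := fun k : ℕ => Real.log (p k) - ((2 * k + c) / 2 * Real.log (27 / 16)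
        + e * Real.log (2 * k + c) + d / (2 * k + c))) (fun k => by
      have hx : 1 ≤ 2 * (k : ℝ) + c := by linarith [(Nat.cast_nonneg k : (0 : ℝ) ≤ k)]
      have hlog : Real.log (p (k + 1)) = Real.log (p k) + Real.log (27 / 16)
          + (Real.log (2 * k + c + a) + Real.log (2 * k + c + b)
          - Real.log (2 * k + c + 3 / 2) - Real.log (2 * k + c + 5 / 2)) := by
        have hc0 : 0 < c := by linarith
        rw [hrec, Real.log_mul (hp k).ne' (by positivity), Real.log_mul (by norm_num) (by positivity),
          log_mul_div_mul (by positivity) (by positivity) (by positivity) (by positivity)]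
        ring
      have hcast : 2 * ((k + 1 : ℕ) : ℝ) + c = 2 * k + c + 2 := by push_cast; ring
      simp only [hcast, hlog]
      generalize 2 * (k : ℝ) + c = x at hx ⊢
      have hx0 : 0 < x := by linarith
      have h := abs_log_increment_le ha hb hx he hd
      rw [← hB] at h
      have hB' : B / x ^ 3 ≤ 2 * B / x ^ 2 - 2 * B / (x + 2) ^ 2 := by
        have : 2 * B / x ^ 2 - 2 * B / (x + 2) ^ 2 - B / x ^ 3
            = B * ((7 * x ^ 2 + 4 * x - 4) / (x ^ 3 * (x + 2) ^ 2)) := by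
          field_simp
          ring
        have h7 : 0 ≤ 7 * x ^ 2 + 4 * x - 4 := by nlinarith
        have : 0 ≤ 2 * B / x ^ 2 - 2 * B / (x + 2) ^ 2 - B / x ^ 3 := by
          rw [this]
          positivity
        linarith
      refine le_trans (le_of_eq ?_) (h.trans hB')
      congr 1
      ring)
  exact ⟨L, 2 * B, by positivity, hL, hbound⟩

lemma gammaN_even_succ (k : ℕ) : gammaN (2 * (k + 1)) = gammaN (2 * k) *
    (2⁻¹ * (((6 * k + 4).factorial : ℝ) * (2 * k + 1).factorial /
      ((4 * k + 2).factorial * (4 * k + 3).factorial))) := by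
  have h (k : ℕ) : 2 * k % 2 = 0 := by lia
  have h' (k : ℕ) : 2 * k / 2 = k := by lia
  simp only [gammaN, h, h', if_true]
  rw [Finset.prod_Icc_succ_top (by lia), pow_succ, show 6 * (k + 1) - 2 = 6 * k + 4 by lia,
    show 2 * (k + 1) - 1 = 2 * k + 1 by lia, show 4 * (k + 1) - 2 = 4 * k + 2 by lia,
    show 4 * (k + 1) - 1 = 4 * k + 3 by lia]
  ring

lemma gammaN_odd_succ (k : ℕ) : gammaN (2 * (k + 1) + 1) = gammaN (2 * k + 1) *
    ((3 * k + 4) * ((6 * k + 6).factorial : ℝ) * (2 * k + 2).factorial /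
      ((4 * k + 4).factorial * (4 * k + 5).factorial)) := by
  have h (k : ℕ) : ¬ (2 * k + 1) % 2 = 0 := by lia
  have h' (k : ℕ) : (2 * k + 1 + 1) / 2 = k + 1 := by lia
  simp only [gammaN, h, h', if_false]
  rw [Finset.prod_range_succ]
  push_cast
  ring_nf

lemma gammaN_zero : gammaN 0 = 1 := by simp [gammaN]

lemma gammaN_one : gammaN 1 = 1 := by simp [gammaN]

lemma gammaN_pos (N : ℕ) : 0 < gammaN N := by
  unfold gammaN
  split_ifs <;> positivity

lemma gammaN_ratio_even_succ (k : ℕ) :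
    gammaN (2 * (k + 1) + 1) / gammaN (2 * (k + 1)) = gammaN (2 * k + 1) / gammaN (2 * k) *
      (27 / 16 * ((k + 4 / 3) * (k + 5 / 6) / ((k + 3 / 4) * (k + 5 / 4)))) := by
  have h₀ := (gammaN_pos (2 * k)).ne'
  have h₁ := (gammaN_pos (2 * k + 1)).ne'
  rw [gammaN_even_succ, gammaN_odd_succ, Nat.factorial_succ (6 * k + 5),
    Nat.factorial_succ (6 * k + 4), Nat.factorial_succ (2 * k + 1), Nat.factorial_succ (4 * k + 4),
    Nat.factorial_succ (4 * k + 3), Nat.factorial_succ (4 * k + 2)]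
  have f₁ : ((6 * k + 4).factorial : ℝ) ≠ 0 := by positivity
  have f₂ : ((2 * k + 1).factorial : ℝ) ≠ 0 := by positivity
  have f₃ : ((4 * k + 2).factorial : ℝ) ≠ 0 := by positivity
  push_cast
  field_simp
  ring

lemma gammaN_ratio_odd_succ (k : ℕ) :
    gammaN (2 * (k + 1 + 1)) / gammaN (2 * (k + 1) + 1) =
      gammaN (2 * (k + 1)) / gammaN (2 * k + 1) *
      (27 / 16 * ((k + 5 / 3) * (k + 7 / 6) / ((k + 5 / 4) * (k + 7 / 4)))) := by
  have h₀ := (gammaN_pos (2 * (k + 1))).ne'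
  have h₁ := (gammaN_pos (2 * k + 1)).ne'
  rw [gammaN_even_succ (k + 1), gammaN_odd_succ, show 6 * (k + 1) + 4 = 6 * k + 6 + 4 by ring,
    show 2 * (k + 1) + 1 = 2 * k + 2 + 1 by ring, show 4 * (k + 1) + 2 = 4 * k + 4 + 2 by ring,
    show 4 * (k + 1) + 3 = 4 * k + 5 + 2 by ring, Nat.factorial_succ (6 * k + 6 + 3),
    Nat.factorial_succ (6 * k + 6 + 2), Nat.factorial_succ (6 * k + 6 + 1),
    Nat.factorial_succ (6 * k + 6), Nat.factorial_succ (2 * k + 2), Nat.factorial_succ (4 * k + 4 + 1),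
    Nat.factorial_succ (4 * k + 4), Nat.factorial_succ (4 * k + 5 + 1),
    Nat.factorial_succ (4 * k + 5), Nat.factorial_succ (4 * k + 4)]
  have f₁ : ((6 * k + 6).factorial : ℝ) ≠ 0 := by positivity
  have f₂ : ((2 * k + 2).factorial : ℝ) ≠ 0 := by positivity
  have f₃ : ((4 * k + 4).factorial : ℝ) ≠ 0 := by positivity
  push_cast
  field_simp
  ring

lemma log_gammaN_ratio_even (k : ℕ) :
    Real.log (gammaN (2 * k + 1) / gammaN (2 * k)) = k * Real.log (27 / 16)
      + ((∑ m ∈ Finset.range k, Real.log (4 / 3 + m)) + (∑ m ∈ Finset.range k, Real.log (5 / 6 + m))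
      - (∑ m ∈ Finset.range k, Real.log (3 / 4 + m))
      - (∑ m ∈ Finset.range k, Real.log (5 / 4 + m))) := by
  induction k with
  | zero => simp [gammaN_zero, gammaN_one]
  | succ k ih =>
    have hpos : 0 < gammaN (2 * k + 1) / gammaN (2 * k) := div_pos (gammaN_pos _) (gammaN_pos _)
    rw [gammaN_ratio_even_succ, Real.log_mul hpos.ne' (by positivity), ih,
      Real.log_mul (by norm_num) (by positivity),
      log_mul_div_mul (by positivity) (by positivity) (by positivity) (by positivity)]
    simp only [Finset.sum_range_succ, add_comm (k : ℝ)]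
    push_cast
    ring

/-- The Gamma-product constant of the even ratio equals `-log K`. -/
lemma log_Gamma_sub_eq_neg_log_Ksusy :
    Real.log (Real.Gamma (3 / 4)) + Real.log (Real.Gamma (5 / 4)) - Real.log (Real.Gamma (4 / 3))
      - Real.log (Real.Gamma (5 / 6)) - 1 / 6 * Real.log 2 = -Real.log Ksusy := by
  have g13 : 0 < Real.Gamma (1 / 3) := Real.Gamma_pos_of_pos (by norm_num)
  have g23 : 0 < Real.Gamma (2 / 3) := Real.Gamma_pos_of_pos (by norm_num)
  have g56 : 0 < Real.Gamma (5 / 6) := Real.Gamma_pos_of_pos (by norm_num)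
  have g14 : 0 < Real.Gamma (1 / 4) := Real.Gamma_pos_of_pos (by norm_num)
  have g34 : 0 < Real.Gamma (3 / 4) := Real.Gamma_pos_of_pos (by norm_num)
  have hpi := Real.pi_pos
  have e54 : Real.log (Real.Gamma (5 / 4)) = Real.log (Real.Gamma (1 / 4)) - 2 * Real.log 2 := by
    rw [show (5 / 4 : ℝ) = 1 / 4 + 1 by norm_num, Real.Gamma_add_one (by norm_num),
      Real.log_mul (by norm_num) g14.ne', one_div, Real.log_inv, show (4 : ℝ) = 2 ^ 2 by norm_num,
      Real.log_pow]
    push_cast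
    ring
  have e43 : Real.log (Real.Gamma (4 / 3)) = Real.log (Real.Gamma (1 / 3)) - Real.log 3 := by
    rw [show (4 / 3 : ℝ) = 1 / 3 + 1 by norm_num, Real.Gamma_add_one (by norm_num),
      Real.log_mul (by norm_num) g13.ne', one_div, Real.log_inv]
    ring
  have e4 : Real.log (Real.Gamma (1 / 4)) + Real.log (Real.Gamma (3 / 4))
      = Real.log Real.pi + 1 / 2 * Real.log 2 := by
    have h := Real.Gamma_mul_Gamma_one_sub (1 / 4)
    rw [show (1 - 1 / 4 : ℝ) = 3 / 4 by norm_num, show Real.pi * (1 / 4) = Real.pi / 4 by ring,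
      Real.sin_pi_div_four] at h
    rw [← Real.log_mul g14.ne' g34.ne', h, Real.log_div hpi.ne' (by positivity),
      Real.log_div (by positivity) (by norm_num), Real.log_sqrt (by norm_num)]
    ring
  have e3 : Real.log (Real.Gamma (1 / 3)) + Real.log (Real.Gamma (2 / 3))
      = Real.log Real.pi + Real.log 2 - 1 / 2 * Real.log 3 := by
    have h := Real.Gamma_mul_Gamma_one_sub (1 / 3)
    rw [show (1 - 1 / 3 : ℝ) = 2 / 3 by norm_num, show Real.pi * (1 / 3) = Real.pi / 3 by ring,
      Real.sin_pi_div_three] at h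
    rw [← Real.log_mul g13.ne' g23.ne', h, Real.log_div hpi.ne' (by positivity),
      Real.log_div (by positivity) (by norm_num), Real.log_sqrt (by norm_num)]
    ring
  have e6 : Real.log (Real.Gamma (1 / 3)) + Real.log (Real.Gamma (5 / 6))
      = Real.log (Real.Gamma (2 / 3)) + 1 / 3 * Real.log 2 + 1 / 2 * Real.log Real.pi := by
    have h := Real.Gamma_mul_Gamma_add_half (1 / 3)
    rw [show (1 / 3 + 1 / 2 : ℝ) = 5 / 6 by norm_num, show (2 * (1 / 3) : ℝ) = 2 / 3 by norm_num,
      show (1 - 2 / 3 : ℝ) = 1 / 3 by norm_num] at h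
    rw [← Real.log_mul g13.ne' g56.ne', h, Real.log_mul (by positivity) (by positivity),
      Real.log_mul (by positivity) (by positivity), Real.log_rpow (by norm_num),
      Real.log_sqrt hpi.le]
    ring
  have eK : Real.log Ksusy = 3 * Real.log 2 - Real.log 3 - Real.log (Real.Gamma (1 / 3))
      + 1 / 2 * (Real.log Real.pi - Real.log 3) := by
    rw [Ksusy, Real.log_mul (by positivity) (by positivity), Real.log_div (by norm_num)
      (by positivity), Real.log_mul (by norm_num) g13.ne', Real.log_sqrt (by positivity),
      Real.log_div hpi.ne' (by norm_num), show (8 : ℝ) = 2 ^ 3 by norm_num, Real.log_pow]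
    push_cast
    ring
  linarith

lemma tendsto_log_gammaN_ratio_even :
    Filter.Tendsto (fun k : ℕ => Real.log (gammaN (2 * (k + 1) + 1) / gammaN (2 * (k + 1)))
      - ((2 * k + 2) / 2 * Real.log (27 / 16) + 1 / 6 * Real.log (2 * k + 2)))
      Filter.atTop (nhds (-Real.log Ksusy)) := by
  have hG (x : ℝ) (hx : 0 < x) := Real.BohrMollerup.tendsto_log_gamma hx
  have hlim : Filter.Tendsto (fun k : ℕ => Real.log ((k : ℝ) / (k + 1))) Filter.atTop (nhds 0) := by
    have h := tendsto_natCast_div_add_atTop (1 : ℝ)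
    simpa [Function.comp_def] using (Real.continuousAt_log one_ne_zero).tendsto.comp h
  have hsum := ((((hG (3 / 4) (by norm_num)).add (hG (5 / 4) (by norm_num))).sub
    (hG (4 / 3) (by norm_num))).sub (hG (5 / 6) (by norm_num))).add
      ((hlim.const_mul (1 / 6)).sub_const (1 / 6 * Real.log 2))
  rw [← log_Gamma_sub_eq_neg_log_Ksusy]
  refine (hsum.congr' ?_).trans (le_of_eq (by congr 1; ring))
  filter_upwards [Filter.eventually_gt_atTop 0] with k hk
  have hk' : (0 : ℝ) < k := by exact_mod_cast hk
  rw [log_gammaN_ratio_even, show (2 * (k : ℝ) + 2) = 2 * (k + 1) by ring,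
    Real.log_mul (by norm_num) (by positivity), Real.log_div (by positivity) (by positivity)]
  simp only [Real.BohrMollerup.logGammaSeq]
  push_cast
  ring

/-- Asymptotics of `log (γ_{N+1} / γ_N)` for even `N`. -/
lemma exists_bound_log_gammaN_ratio_even : ∃ C : ℝ, 0 < C ∧ ∀ N : ℕ, Even N → 2 ≤ N →
    |Real.log (gammaN (N + 1) / gammaN N) - ((N : ℝ) / 2 * Real.log (27 / 16)
      + 1 / 6 * Real.log N + 13 / 72 / N) - -Real.log Ksusy| ≤ C / (N : ℝ) ^ 2 := by
  obtain ⟨L, C, hC, hL, hbound⟩ := exists_log_asymptotics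
    (p := fun k => gammaN (2 * (k + 1) + 1) / gammaN (2 * (k + 1)))
    (fun k => div_pos (gammaN_pos _) (gammaN_pos _)) (a := 8 / 3) (b := 5 / 3) (e := 1 / 6)
    (d := 13 / 72) (c := 2) (by norm_num) (by norm_num) (by norm_num) (by norm_num) (by norm_num)
    (fun k => by
      rw [gammaN_ratio_even_succ (k + 1)]
      push_cast
      field_simp
      ring)
  have htop : Filter.Tendsto (fun k : ℕ => 2 * (k : ℝ) + 2) Filter.atTop Filter.atTop :=
    Filter.tendsto_atTop_add_const_right _ _
      (tendsto_natCast_atTop_atTop.const_mul_atTop (by norm_num))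
  have hL' : L = -Real.log Ksusy := by
    refine tendsto_nhds_unique hL ?_
    have h := tendsto_log_gammaN_ratio_even.sub (htop.const_div_atTop (13 / 72))
    rw [sub_zero] at h
    exact h.congr fun k => by ring
  refine ⟨C, hC, fun N hN hN2 => ?_⟩
  obtain ⟨k, rfl⟩ : ∃ k, N = 2 * (k + 1) := by
    obtain ⟨m, rfl⟩ := hN
    exact ⟨m - 1, by lia⟩
  have hcast : ((2 * (k + 1) : ℕ) : ℝ) = 2 * k + 2 := by push_cast; ring
  rw [hcast, ← hL']
  exact hbound k

/-- Asymptotics of `log (γ_{N+1} / γ_N)` for odd `N`. -/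
lemma exists_bound_log_gammaN_ratio_odd : ∃ L C : ℝ, 0 < C ∧ ∀ N : ℕ, Odd N →
    |Real.log (gammaN (N + 1) / gammaN N) - ((N : ℝ) / 2 * Real.log (27 / 16)
      + -1 / 6 * Real.log N + -11 / 72 / N) - L| ≤ C / (N : ℝ) ^ 2 := by
  obtain ⟨L, C, hC, -, hbound⟩ := exists_log_asymptotics
    (p := fun k => gammaN (2 * (k + 1)) / gammaN (2 * k + 1))
    (fun k => div_pos (gammaN_pos _) (gammaN_pos _)) (a := 7 / 3) (b := 4 / 3) (e := -1 / 6)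
    (d := -11 / 72) (c := 1) (by norm_num) (by norm_num) (by norm_num) (by norm_num) (by norm_num)
    (fun k => by
      rw [gammaN_ratio_odd_succ k]
      field_simp
      ring)
  refine ⟨L, C, hC, fun N hN => ?_⟩
  obtain ⟨k, rfl⟩ := hN
  have h := hbound k
  rw [show 2 * (k + 1) = 2 * k + 1 + 1 by ring] at h
  push_cast
  exact h

lemma Gsusy_eq (N1 N2 : ℕ) : Gsusy N1 N2 = Real.log (gammaN (N1 + 1) / gammaN N1)
    + Real.log (gammaN (N2 + 1) / gammaN N2)
    - Real.log (gammaN (N1 + N2 + 1) / gammaN (N1 + N2)) := by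
  have h (N : ℕ) : gammaN N ≠ 0 := (gammaN_pos N).ne'
  rw [Gsusy, Real.log_div (by simp [h]) (by simp [h]), Real.log_mul (by simp [h]) (h _),
    Real.log_mul (h _) (h _), Real.log_mul (by simp [h]) (h _), Real.log_mul (h _) (h _),
    Real.log_div (h _) (h _), Real.log_div (h _) (h _), Real.log_div (h _) (h _)]
  ring

/-- **Equation (86).** Asymptotics of the supersymmetric-point LBF for
`N1` even and `N2` odd, with error `O(N^{−2})` uniformly for `δ ≤ ξ ≤ 1−δ`. -/
theorem susy_lbf_asymptotics_even_odd :
    ∀ δ ∈ Set.Ioo (0:ℝ) (1/2), ∃ C > (0:ℝ), ∃ N₀ : ℕ,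
      ∀ N1 N2 : ℕ, Even N1 → Odd N2 → 2 ≤ N1 → 2 ≤ N2 → N₀ ≤ N1 + N2 →
        δ ≤ (N1:ℝ)/((N1:ℝ)+N2) → (N1:ℝ)/((N1:ℝ)+N2) ≤ 1 - δ →
        |Gsusy N1 N2
          - ((1/6) * Real.log ((N1:ℝ)+N2)
            + (1/6) * Real.log (((N1:ℝ)/((N1:ℝ)+N2)) / (1 - (N1:ℝ)/((N1:ℝ)+N2)))
            - Real.log Ksusy
            + (1/72) * (13/((N1:ℝ)/((N1:ℝ)+N2))
                + 11 * (1 - 1/(1 - (N1:ℝ)/((N1:ℝ)+N2))))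
                / ((N1:ℝ)+N2))|
        ≤ C / ((N1:ℝ)+N2)^2 := by
  rintro δ ⟨hδ, -⟩
  obtain ⟨C₀, hC₀, h₀⟩ := exists_bound_log_gammaN_ratio_even
  obtain ⟨L, C₁, hC₁, h₁⟩ := exists_bound_log_gammaN_ratio_odd
  refine ⟨C₀ / δ ^ 2 + C₁ / δ ^ 2 + C₁, by positivity, 0, ?_⟩
  intro N1 N2 hN1 hN2 hN1' hN2' _ hlow hup
  have b₀ := h₀ N1 hN1 hN1'
  have b₁ := h₁ N2 hN2
  have b₂ := h₁ (N1 + N2) (hN1.add_odd hN2)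
  rw [Gsusy_eq]
  have hx : (0 : ℝ) < N1 := by exact_mod_cast (by lia : 0 < N1)
  have hy : (0 : ℝ) < N2 := by exact_mod_cast (by lia : 0 < N2)
  push_cast at b₂
  generalize (N1 : ℝ) = x at *
  generalize (N2 : ℝ) = y at *
  have hxi : 1 - x / (x + y) = y / (x + y) := by field_simp; ring
  have hx' : δ * (x + y) ≤ x := (le_div_iff₀ (by positivity)).1 hlow
  have hy' : δ * (x + y) ≤ y :=
    (le_div_iff₀ (by positivity)).1 (by linarith : δ ≤ y / (x + y))
  have c₀ : C₀ / x ^ 2 ≤ C₀ / δ ^ 2 / (x + y) ^ 2 := by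
    rw [div_div, ← mul_pow]
    gcongr
  have c₁ : C₁ / y ^ 2 ≤ C₁ / δ ^ 2 / (x + y) ^ 2 := by
    rw [div_div, ← mul_pow]
    gcongr
  have hlog : Real.log (x / (x + y) / (1 - x / (x + y))) = Real.log x - Real.log y := by
    rw [hxi, div_div_div_cancel_right₀ (by positivity), Real.log_div hx.ne' hy.ne']
  have hcorr : 1 / 72 * (13 / (x / (x + y)) + 11 * (1 - 1 / (1 - x / (x + y)))) / (x + y)
      = 13 / 72 / x + -11 / 72 / y - -11 / 72 / (x + y) := by
    rw [hxi]
    field_simp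
    ring
  rw [hlog, hcorr, add_div, add_div]
  rw [abs_le] at b₀ b₁ b₂ ⊢
  constructor <;> linarith

end
end

section
/- Let N ≥ 2, let X_N be an extension of the symplectic character ratio of size N and X_{N−1} an extension of the symplectic character ratio of size N−1. Then for all nonzero complex z_1, …, z_{N−1}, the limit as real t → +∞ of t^{−(⌈N/2⌉−1)} · X_N(z_1, …, z_{N−1}, t) equals X_{N−1}(z_1, …, z_{N−1}). -/
noncomputable section

open Filter Topology Polynomial

/-- A point off the zero set of the Weyl denominator of the symplectic group. -/
def SymplecticRegular {n : ℕ} (z : Fin n → ℂ) : Prop :=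
  (∀ i, z i ≠ 0 ∧ z i ^ 2 ≠ 1) ∧ ∀ i j, i ≠ j → z i ≠ z j ∧ z i * z j ≠ 1

/-- The numbers `z_j`, `z_j⁻¹`, `1` and `-1`. -/
def symplecticNode {n : ℕ} (z : Fin n → ℂ) : (Fin n ⊕ Fin n) ⊕ Bool → ℂ :=
  Sum.elim (Sum.elim z fun j => (z j)⁻¹) fun b => if b then 1 else -1

theorem SymplecticRegular.injective_symplecticNode {n : ℕ} {z : Fin n → ℂ}
    (hz : SymplecticRegular z) : Function.Injective (symplecticNode z) := by
  have hne : ∀ i, z i ≠ 0 := fun i => (hz.1 i).1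
  have hsq : ∀ i, z i ^ 2 ≠ 1 := fun i => (hz.1 i).2
  have hinj : ∀ i j, z i = z j → i = j := fun i j h => by
    by_contra hij
    exact (hz.2 i j hij).1 h
  have hmul : ∀ i j, z i * z j ≠ 1 := fun i j h => by
    by_cases hij : i = j
    · exact hsq i (by rw [sq]; nth_rewrite 2 [hij]; exact h)
    · exact (hz.2 i j hij).2 h
  have hone : ∀ i (b : Bool), z i ≠ if b then 1 else -1 := fun i b h =>
    hsq i (by rw [h]; cases b <;> simp)
  have hinvone : ∀ i (b : Bool), (z i)⁻¹ ≠ if b then 1 else -1 := fun i b h =>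
    hsq i (by rw [← inv_inv (z i), h]; cases b <;> norm_num)
  have hinv : ∀ i j, z i ≠ (z j)⁻¹ := fun i j h =>
    hmul i j (by rw [h, inv_mul_cancel₀ (hne j)])
  rintro ((i | i) | b) ((j | j) | c) h
  · simpa [symplecticNode] using hinj i j h
  · exact absurd h (hinv i j)
  · exact absurd h (hone i c)
  · exact absurd h.symm (hinv j i)
  · simpa [symplecticNode] using hinj i j (inv_injective h)
  · exact absurd h (hinvone i c)
  · exact absurd h.symm (hone j b)
  · exact absurd h.symm (hinvone j b)
  · revert h
    cases b <;> cases c <;> norm_num [symplecticNode]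

/-- The monic polynomial with roots `z_j`, `z_j⁻¹`, `1` and `-1`. -/
def symplecticNodal {n : ℕ} (z : Fin n → ℂ) : ℂ[X] :=
  ∏ a, (X - C (symplecticNode z a))

theorem monic_symplecticNodal {n : ℕ} (z : Fin n → ℂ) : (symplecticNodal z).Monic :=
  monic_prod_of_monic _ _ fun _ _ => monic_X_sub_C _

theorem natDegree_symplecticNodal {n : ℕ} (z : Fin n → ℂ) :
    (symplecticNodal z).natDegree = 2 * (n + 1) := by
  rw [symplecticNodal, natDegree_prod_of_monic _ _ fun _ _ => monic_X_sub_C _]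
  simp
  ring

theorem sdet_snoc {n : ℕ} (e : Fin (n + 1) → ℕ) (z : Fin n → ℂ) (t : ℂ) :
    sdet (n + 1) e (Fin.snoc (α := fun _ => ℂ) z t) =
      ∑ i, (-1) ^ (i.1 + n) * sdet n (fun a => e (i.succAbove a)) z *
        (t ^ (e i : ℤ) - t ^ (-(e i : ℤ))) := by
  rw [sdet, Matrix.det_succ_column _ (Fin.last n)]
  refine Finset.sum_congr rfl fun i _ => ?_
  have : ((Matrix.of fun i j : Fin (n + 1) =>
      (Fin.snoc (α := fun _ => ℂ) z t j : ℂ) ^ (e i : ℤ) -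
        (Fin.snoc (α := fun _ => ℂ) z t j : ℂ) ^ (-(e i : ℤ))).submatrix
        i.succAbove (Fin.last n).succAbove).det =
      sdet n (fun a => e (i.succAbove a)) z := by
    rw [sdet]
    congr 1
    ext a b
    simp
  rw [this]
  simp
  ring

/-- The polynomial in `t` that equals `t ^ M * det (z_j ^ {e_i} - z_j ^ {-e_i})` where the
last variable is `t`. -/
def sdetPoly {n : ℕ} (e : Fin (n + 1) → ℕ) (M : ℕ) (z : Fin n → ℂ) : ℂ[X] :=
  ∑ i, C ((-1) ^ (i.1 + n) * sdet n (fun a => e (i.succAbove a)) z) *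
    (X ^ (M + e i) - X ^ (M - e i))

theorem eval_sdetPoly {n : ℕ} {e : Fin (n + 1) → ℕ} {M : ℕ} (he : ∀ i, e i ≤ M)
    (z : Fin n → ℂ) {t : ℂ} (ht : t ≠ 0) :
    (sdetPoly e M z).eval t = t ^ M * sdet (n + 1) e (Fin.snoc (α := fun _ => ℂ) z t) := by
  rw [sdet_snoc, sdetPoly, eval_finsetSum, Finset.mul_sum]
  refine Finset.sum_congr rfl fun i _ => ?_
  have h1 : t ^ (M + e i) = t ^ M * t ^ (e i : ℤ) := by rw [pow_add, zpow_natCast]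
  have h2 : t ^ (M - e i) = t ^ M * t ^ (-(e i : ℤ)) := by
    rw [zpow_neg, zpow_natCast, pow_sub₀ _ ht (he i)]
  simp only [eval_mul, eval_C, eval_sub, eval_pow, eval_X, h1, h2]
  ring

theorem natDegree_sdetPoly_le {n : ℕ} {e : Fin (n + 1) → ℕ} {M : ℕ} (he : ∀ i, e i ≤ M)
    (z : Fin n → ℂ) : (sdetPoly e M z).natDegree ≤ 2 * M := by
  refine natDegree_sum_le_of_forall_le _ _ fun i _ => ?_
  refine (natDegree_C_mul_le _ _).trans ((natDegree_sub_le _ _).trans ?_)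
  have := he i
  simp only [natDegree_X_pow]
  omega

theorem coeff_sdetPoly {n : ℕ} {e : Fin (n + 1) → ℕ} (h0 : 0 < e 0)
    (he : ∀ i, i ≠ 0 → e i < e 0) (z : Fin n → ℂ) :
    (sdetPoly e (e 0) z).coeff (2 * e 0) = (-1) ^ n * sdet n (fun a => e a.succ) z := by
  rw [sdetPoly, finsetSum_coeff, Finset.sum_eq_single 0]
  · rw [coeff_C_mul, coeff_sub, coeff_X_pow, coeff_X_pow, if_pos (by omega),
      if_neg (by omega)]
    simp
  · intro i _ hi
    have := he i hi
    rw [coeff_C_mul, coeff_sub, coeff_X_pow, coeff_X_pow, if_neg (by omega),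
      if_neg (by omega)]
    simp
  · simp

theorem sdet_snoc_symplecticNode {n : ℕ} (e : Fin (n + 1) → ℕ) (z : Fin n → ℂ)
    (a : (Fin n ⊕ Fin n) ⊕ Bool) :
    sdet (n + 1) e (Fin.snoc (α := fun _ => ℂ) z (symplecticNode z a)) = 0 := by
  have hz : ∀ j, sdet (n + 1) e (Fin.snoc (α := fun _ => ℂ) z (z j)) = 0 := fun j =>
    Matrix.det_zero_of_column_eq (i := j.castSucc) (j := Fin.last n)
      (Fin.castSucc_lt_last j).ne fun k => by simp
  rcases a with (j | j) | b
  · exact hz j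
  · rw [← neg_eq_zero, ← hz j, sdet_snoc, sdet_snoc, ← Finset.sum_neg_distrib]
    refine Finset.sum_congr rfl fun i _ => ?_
    simp only [symplecticNode, Sum.elim_inl, Sum.elim_inr, inv_zpow', neg_neg]
    ring
  · rw [sdet_snoc]
    refine Finset.sum_eq_zero fun i _ => ?_
    cases b <;> simp [symplecticNode, ← inv_pow, inv_neg]

theorem symplecticNodal_dvd_sdetPoly {n : ℕ} {e : Fin (n + 1) → ℕ} {M : ℕ}
    (he : ∀ i, e i ≤ M) {z : Fin n → ℂ} (hz : SymplecticRegular z) :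
    symplecticNodal z ∣ sdetPoly e M z := by
  refine Fintype.prod_dvd_of_coprime
    (pairwise_coprime_X_sub_C hz.injective_symplecticNode) fun a => ?_
  have h0 : symplecticNode z a ≠ 0 := by
    rcases a with (j | j) | b
    · exact (hz.1 j).1
    · exact inv_ne_zero (hz.1 j).1
    · cases b <;> simp [symplecticNode]
  rw [dvd_iff_isRoot, IsRoot.def, eval_sdetPoly he z h0, sdet_snoc_symplecticNode, mul_zero]

theorem deltaE_le (n : ℕ) (i : Fin (n + 1)) : deltaE (n + 1) i ≤ n + 1 := by
  simp [deltaE]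

theorem muE_le (n : ℕ) (i : Fin (n + 1)) : muE (n + 1) i ≤ n + 1 + n / 2 := by
  simp only [muE]
  omega

theorem coeff_sdetPoly_deltaE {n : ℕ} (z : Fin n → ℂ) :
    (sdetPoly (deltaE (n + 1)) (n + 1) z).coeff (2 * (n + 1)) =
      (-1) ^ n * sdet n (deltaE n) z := by
  have h0 : deltaE (n + 1) 0 = n + 1 := by simp [deltaE]
  have := coeff_sdetPoly (e := deltaE (n + 1)) (by omega)
    (fun i hi => by have := Fin.pos_iff_ne_zero.2 hi; simp [deltaE]; omega) z
  rw [h0] at this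
  rw [this]
  congr 2
  funext a
  simp [deltaE]

theorem coeff_sdetPoly_muE {n : ℕ} (z : Fin n → ℂ) :
    (sdetPoly (muE (n + 1)) (n + 1 + n / 2) z).coeff (2 * (n + 1 + n / 2)) =
      (-1) ^ n * sdet n (muE n) z := by
  have h0 : muE (n + 1) 0 = n + 1 + n / 2 := by simp [muE]; omega
  have := coeff_sdetPoly (e := muE (n + 1)) (by omega)
    (fun i hi => by have := Fin.pos_iff_ne_zero.2 hi; simp [muE]; omega) z
  rw [h0] at this
  rw [this]
  congr 2
  funext a
  simp [muE]

theorem sdetPoly_deltaE_eq {n : ℕ} {z : Fin n → ℂ} (hz : SymplecticRegular z) :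
    sdetPoly (deltaE (n + 1)) (n + 1) z =
      symplecticNodal z * C ((-1) ^ n * sdet n (deltaE n) z) := by
  obtain ⟨q, hq⟩ := symplecticNodal_dvd_sdetPoly (deltaE_le n) hz
  have hdeg : q.natDegree = 0 := by
    by_cases h : q = 0
    · simp [h]
    have := natDegree_sdetPoly_le (deltaE_le n) z
    rw [hq, (monic_symplecticNodal z).natDegree_mul' h, natDegree_symplecticNodal] at this
    omega
  have hc := coeff_sdetPoly_deltaE z
  rw [hq, ← add_zero (2 * (n + 1)), coeff_mul_add_eq_of_natDegree_le
    (natDegree_symplecticNodal z).le hdeg.le, ← natDegree_symplecticNodal z,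
    (monic_symplecticNodal z).coeff_natDegree, one_mul] at hc
  rw [hq, ← hc, ← eq_C_of_natDegree_eq_zero hdeg]

theorem SymplecticRegular.of_snoc {n : ℕ} {z : Fin n → ℂ} {t : ℂ}
    (h : SymplecticRegular (Fin.snoc (α := fun _ => ℂ) z t)) : SymplecticRegular z :=
  ⟨fun i => by simpa using h.1 i.castSucc, fun i j hij => by
    simpa using h.2 i.castSucc j.castSucc (by simpa using hij)⟩

theorem SymplecticRegular.eval_symplecticNodal_ne_zero {n : ℕ} {z : Fin n → ℂ} {t : ℂ}
    (h : SymplecticRegular (Fin.snoc (α := fun _ => ℂ) z t)) :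
    (symplecticNodal z).eval t ≠ 0 := by
  rw [symplecticNodal, eval_prod, Finset.prod_ne_zero_iff]
  intro a _
  rw [eval_sub, eval_X, eval_C, sub_ne_zero]
  have ht : t ^ 2 ≠ 1 := by simpa using (h.1 (Fin.last n)).2
  rcases a with (j | j) | b
  · simpa [symplecticNode] using (h.2 (Fin.last n) j.castSucc (Fin.castSucc_lt_last j).ne').1
  · intro h'
    have h0 : z j ≠ 0 := (h.of_snoc.1 j).1
    have := (h.2 (Fin.last n) j.castSucc (Fin.castSucc_lt_last j).ne').2
    simp only [Fin.snoc_last, Fin.snoc_castSucc] at this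
    exact this (by rw [h']; exact inv_mul_cancel₀ h0)
  · rintro rfl
    cases b <;> simp [symplecticNode] at ht

theorem SymplecticRegular.sdet_deltaE_ne_zero {n : ℕ} {z : Fin n → ℂ}
    (hz : SymplecticRegular z) : sdet n (deltaE n) z ≠ 0 := by
  induction n with
  | zero => simp [sdet]
  | succ n ih =>
    obtain ⟨y, t, rfl⟩ : ∃ (y : Fin n → ℂ) (t : ℂ), z = Fin.snoc (α := fun _ => ℂ) y t :=
      ⟨Fin.init z, z (Fin.last n), (Fin.snoc_init_self z).symm⟩
    have ht : t ≠ 0 := by simpa using (hz.1 (Fin.last n)).1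
    have h := eval_sdetPoly (deltaE_le n) y ht
    rw [sdetPoly_deltaE_eq hz.of_snoc, eval_mul, eval_C] at h
    refine right_ne_zero_of_mul (a := t ^ (n + 1)) ?_
    rw [← h]
    exact mul_ne_zero hz.eval_symplecticNodal_ne_zero
      (mul_ne_zero (pow_ne_zero _ (by norm_num)) (ih hz.of_snoc))

/-- In the last variable, the symplectic character is a Laurent polynomial whose leading
coefficient is the symplectic character of one size less. -/
theorem exists_laurent_polynomial {n : ℕ} {z : Fin n → ℂ} (hz : SymplecticRegular z) :
    ∃ q : ℂ[X], q.natDegree ≤ 2 * (n / 2) ∧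
      q.coeff (2 * (n / 2)) = sdet n (muE n) z / sdet n (deltaE n) z ∧
      ∀ t, SymplecticRegular (Fin.snoc (α := fun _ => ℂ) z t) →
        q.eval t = t ^ (n / 2) *
          (sdet (n + 1) (muE (n + 1)) (Fin.snoc (α := fun _ => ℂ) z t) /
            sdet (n + 1) (deltaE (n + 1)) (Fin.snoc (α := fun _ => ℂ) z t)) := by
  obtain ⟨q, hq⟩ := symplecticNodal_dvd_sdetPoly (muE_le n) hz
  set c : ℂ := (-1) ^ n * sdet n (deltaE n) z with hc
  have hs : (-1 : ℂ) ^ n ≠ 0 := pow_ne_zero _ (by norm_num)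
  have hc0 : c ≠ 0 := mul_ne_zero hs hz.sdet_deltaE_ne_zero
  have hdeg : q.natDegree ≤ 2 * (n / 2) := by
    by_cases h : q = 0
    · simp [h]
    have := natDegree_sdetPoly_le (muE_le n) z
    rw [hq, (monic_symplecticNodal z).natDegree_mul' h, natDegree_symplecticNodal] at this
    omega
  refine ⟨C c⁻¹ * q, (natDegree_C_mul_le _ _).trans hdeg, ?_, fun t ht => ?_⟩
  · have h := coeff_sdetPoly_muE z
    rw [hq, mul_add, coeff_mul_add_eq_of_natDegree_le (natDegree_symplecticNodal z).le hdeg,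
      ← natDegree_symplecticNodal z, (monic_symplecticNodal z).coeff_natDegree, one_mul] at h
    rw [coeff_C_mul, h, hc]
    have := hz.sdet_deltaE_ne_zero
    field_simp
  · have ht0 : t ≠ 0 := by simpa using (ht.1 (Fin.last n)).1
    have h1 := eval_sdetPoly (muE_le n) z ht0
    have h2 := eval_sdetPoly (deltaE_le n) z ht0
    rw [hq, eval_mul] at h1
    rw [sdetPoly_deltaE_eq hz, ← hc, eval_mul, eval_C] at h2
    have hR := ht.eval_symplecticNodal_ne_zero
    have hd := ht.sdet_deltaE_ne_zero
    have hp : t ^ (n + 1) ≠ 0 := pow_ne_zero _ ht0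
    rw [eval_mul, eval_C, ← mul_div_assoc, eq_div_iff hd, inv_mul_eq_div, div_mul_eq_mul_div,
      div_eq_iff hc0]
    refine mul_left_cancel₀ hp (mul_left_cancel₀ hR ?_)
    rw [pow_add] at h1
    linear_combination (eval t (symplecticNodal z) * c) * h1 -
      (eval t q * eval t (symplecticNodal z)) * h2

theorem eventually_cofinite_quadratic_ne_zero {a b c : ℂ} (h : a ≠ 0 ∨ b ≠ 0 ∨ c ≠ 0) :
    ∀ᶠ x : ℂ in cofinite, a + b * x + c * x ^ 2 ≠ 0 := by
  have hp : C a + C b * X + C c * X ^ 2 ≠ (0 : ℂ[X]) := fun h0 => by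
    have h1 := congrArg (coeff · 0) h0
    have h2 := congrArg (coeff · 1) h0
    have h3 := congrArg (coeff · 2) h0
    simp [coeff_X, coeff_C, coeff_X_pow] at h1 h2 h3
    tauto
  refine (finite_setOfPred_isRoot hp).subset fun x hx => ?_
  simpa [IsRoot.def] using hx

theorem eventually_symplecticRegular_line {m : ℕ} {w d : Fin m → ℂ}
    (hd : Function.Injective d) (hw : ∀ i, w i ≠ 0) (hdw : ∀ i, d i = 0 → w i ^ 2 ≠ 1) :
    ∀ᶠ x : ℂ in cofinite, SymplecticRegular (fun i => w i + x * d i) := by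
  have hne : ∀ i, ∀ᶠ x : ℂ in cofinite, w i + x * d i ≠ 0 := fun i => by
    filter_upwards [eventually_cofinite_quadratic_ne_zero (a := w i) (b := d i) (c := 0)
      (Or.inl (hw i))] with x hx h
    exact hx (by linear_combination h)
  have hsq : ∀ i, ∀ᶠ x : ℂ in cofinite, (w i + x * d i) ^ 2 ≠ 1 := fun i => by
    filter_upwards [eventually_cofinite_quadratic_ne_zero (a := w i ^ 2 - 1)
      (b := 2 * w i * d i) (c := d i ^ 2) (by
        by_cases h : d i = 0
        · exact Or.inl (sub_ne_zero.2 (hdw i h))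
        · exact Or.inr (Or.inr (pow_ne_zero _ h)))] with x hx h
    exact hx (by linear_combination h)
  have hsub : ∀ i j, i ≠ j → ∀ᶠ x : ℂ in cofinite, w i + x * d i ≠ w j + x * d j :=
    fun i j hij => by
    filter_upwards [eventually_cofinite_quadratic_ne_zero (a := w i - w j)
      (b := d i - d j) (c := 0) (Or.inr (Or.inl (sub_ne_zero.2 (hd.ne hij))))] with x hx h
    exact hx (by linear_combination h)
  have hmul : ∀ i j, i ≠ j → ∀ᶠ x : ℂ in cofinite,
      (w i + x * d i) * (w j + x * d j) ≠ 1 := fun i j hij => by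
    filter_upwards [eventually_cofinite_quadratic_ne_zero (a := w i * w j - 1)
      (b := w i * d j + w j * d i) (c := d i * d j) (by
        by_cases hi : d i = 0
        · have hj : d j ≠ 0 := fun hj => hij (hd (hi.trans hj.symm))
          exact Or.inr (Or.inl (by simpa [hi] using ⟨hw i, hj⟩))
        by_cases hj : d j = 0
        · exact Or.inr (Or.inl (by simpa [hj] using ⟨hw j, hi⟩))
        · exact Or.inr (Or.inr (mul_ne_zero hi hj)))] with x hx h
    exact hx (by linear_combination h)
  refine (eventually_all.2 fun i => (hne i).and (hsq i)).and
    (eventually_all.2 fun i => eventually_all.2 fun j => ?_)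
  by_cases hij : i = j
  · simp [hij]
  · simpa [hij] using (hsub i j hij).and (hmul i j hij)

theorem eventually_symplecticRegular_snoc {n : ℕ} {z : Fin n → ℂ} (hz : ∀ i, z i ≠ 0)
    {t : ℂ} (ht : t ≠ 0) (ht' : t ^ 2 ≠ 1) :
    ∀ᶠ x : ℂ in 𝓝[≠] 0,
      SymplecticRegular (Fin.snoc (α := fun _ => ℂ) (fun i => z i + x * (i.1 + 1)) t) := by
  refine nhdsNE_le_cofinite 0 ?_
  have hne : ∀ i : Fin n, (i.1 : ℂ) + 1 ≠ 0 := fun i => Nat.cast_add_one_ne_zero _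
  have h := eventually_symplecticRegular_line (w := Fin.snoc (α := fun _ => ℂ) z t)
    (d := Fin.snoc (α := fun _ => ℂ) (fun i : Fin n => (i.1 : ℂ) + 1) 0) ?_ ?_ ?_
  · filter_upwards [h] with x hx
    convert hx using 1
    funext i
    refine Fin.lastCases ?_ (fun i => ?_) i <;> simp
  · refine Fin.snoc_injective_of_injective (fun i j h => ?_) ?_
    · exact Fin.ext (by exact_mod_cast add_right_cancel h)
    · rintro ⟨i, hi⟩
      exact hne i hi
  · intro i
    refine Fin.lastCases ?_ (fun i => ?_) i
    · simpa using ht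
    · simpa using hz i
  · intro i
    refine Fin.lastCases ?_ (fun i => ?_) i
    · simpa using ht'
    · intro h
      exact absurd (by simpa using h) (hne i)

theorem IsSymplecticExt.tendsto {n : ℕ} {Y : (Fin n → ℂ) → ℂ} (hY : IsSymplecticExt n Y)
    {w : Fin n → ℂ} (hw : ∀ i, w i ≠ 0) {f : ℂ → Fin n → ℂ} (hf : Continuous f)
    (hf0 : f 0 = w) : Tendsto (fun x => Y (f x)) (𝓝[≠] 0) (𝓝 (Y w)) := by
  have hopen : IsOpen {z : Fin n → ℂ | ∀ i, z i ≠ 0} := by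
    simp only [Set.ofPred_forall]
    exact isOpen_iInter_of_finite fun i => isOpen_ne_fun (continuous_apply i) continuous_const
  have hcont : Tendsto Y (𝓝 w) (𝓝 (Y w)) := hY.1.continuousAt (hopen.mem_nhds hw)
  have h := hf.tendsto 0
  rw [hf0] at h
  exact hcont.comp (h.mono_left nhdsWithin_le_nhds)

theorem tendsto_zpow_neg_mul_eval {q : ℂ[X]} {m : ℕ} (hq : q.natDegree ≤ m) :
    Tendsto (fun t : ℝ => (t : ℂ) ^ (-(m : ℤ)) * q.eval (t : ℂ)) atTop (𝓝 (q.coeff m)) := by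
  have hterm : ∀ i ∈ Finset.range m,
      Tendsto (fun t : ℝ => q.coeff i * ((t : ℂ) ^ (m - i))⁻¹) atTop (𝓝 0) := by
    intro i hi
    have hi := Finset.mem_range.1 hi
    have h := (tendsto_pow_neg_atTop (𝕜 := ℝ) (n := m - i) (by omega)).ofReal
    simpa [zpow_neg] using h.const_mul (q.coeff i)
  have h := (tendsto_finsetSum _ hterm).add_const (q.coeff m)
  rw [Finset.sum_const_zero, zero_add] at h
  refine h.congr' ?_
  filter_upwards [eventually_gt_atTop 0] with t ht
  have ht : (t : ℂ) ≠ 0 := by exact_mod_cast ht.ne'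
  rw [eval_eq_sum_range' (Nat.lt_succ_of_le hq), Finset.sum_range_succ, mul_add,
    Finset.mul_sum, zpow_neg, zpow_natCast]
  congr 1
  · refine Finset.sum_congr rfl fun i hi => ?_
    have hi := Finset.mem_range.1 hi
    rw [pow_sub₀ _ ht hi.le]
    field_simp
  · field_simp

theorem IsSymplecticExt.tendsto_snoc {n : ℕ} {Y : (Fin (n + 1) → ℂ) → ℂ}
    (hY : IsSymplecticExt (n + 1) Y) {Z : (Fin n → ℂ) → ℂ} (hZ : IsSymplecticExt n Z)
    {z : Fin n → ℂ} (hz : ∀ i, z i ≠ 0) :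
    Tendsto (fun t : ℝ => (t : ℂ) ^ (-((n / 2 : ℕ) : ℤ)) *
      Y (Fin.snoc (α := fun _ => ℂ) z (t : ℂ))) atTop (𝓝 (Z z)) := by
  set K := n / 2
  let s : Finset ℕ := Finset.range (2 * K + 1)
  let v : ℕ → ℂ := fun k => (k : ℂ) + 2
  have hv : Set.InjOn v s := fun i _ j _ h => by exact_mod_cast add_right_cancel h
  have hv0 : ∀ k, v k ≠ 0 := fun k h => by
    have : (k : ℂ) + 2 = 0 := h
    have : k + 2 = 0 := by exact_mod_cast this
    omega
  have hv1 : ∀ k, v k ^ 2 ≠ 1 := fun k h => by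
    have : ((k : ℂ) + 2) ^ 2 = 1 := h
    have : (k + 2) ^ 2 = 1 := by exact_mod_cast this
    have := Nat.pow_eq_one.1 this
    omega
  let y : ℂ → Fin n → ℂ := fun x i => z i + x * (i.1 + 1)
  have hy : Continuous y := by fun_prop
  have hy0 : y 0 = z := by simp [y]
  let p : (Fin n → ℂ) → ℂ[X] := fun u =>
    ∑ k ∈ s, C (v k ^ K * Y (Fin.snoc (α := fun _ => ℂ) u (v k))) * Lagrange.basis s v k
  have hp : ∀ u, p u = Lagrange.interpolate s v
      fun k => v k ^ K * Y (Fin.snoc (α := fun _ => ℂ) u (v k)) := fun u => by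
    rw [Lagrange.interpolate_apply]
  have hcont : ∀ t, Continuous fun x => (Fin.snoc (α := fun _ => ℂ) (y x) t : Fin (n + 1) → ℂ) :=
    fun t => continuous_pi fun i => by
      refine Fin.lastCases ?_ (fun i => ?_) i
      · simpa using continuous_const
      · simpa [Function.comp_def] using (continuous_apply i).comp hy
  have hYlim : ∀ t, t ≠ 0 → Tendsto (fun x => Y (Fin.snoc (α := fun _ => ℂ) (y x) t))
      (𝓝[≠] 0) (𝓝 (Y (Fin.snoc (α := fun _ => ℂ) z t))) := fun t ht => by
    refine hY.tendsto (fun i => ?_) (hcont t) (by rw [hy0])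
    refine Fin.lastCases ?_ (fun i => ?_) i
    · simpa using ht
    · simpa using hz i
  have hreg : ∀ t, t ≠ 0 → t ^ 2 ≠ 1 → ∀ᶠ x in 𝓝[≠] 0,
      SymplecticRegular (Fin.snoc (α := fun _ => ℂ) (y x) t) := fun t ht ht' =>
    eventually_symplecticRegular_snoc hz ht ht'
  have hval : ∀ u t, SymplecticRegular (Fin.snoc (α := fun _ => ℂ) u t : Fin (n + 1) → ℂ) →
      Y (Fin.snoc (α := fun _ => ℂ) u t) =
        sdet (n + 1) (muE (n + 1)) (Fin.snoc (α := fun _ => ℂ) u t) /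
          sdet (n + 1) (deltaE (n + 1)) (Fin.snoc (α := fun _ => ℂ) u t) := fun u t h =>
    hY.2 _ (fun i => (h.1 i).1) h.sdet_deltaE_ne_zero
  have hnodes : ∀ᶠ x in 𝓝[≠] (0 : ℂ), ∀ k ∈ s,
      SymplecticRegular (Fin.snoc (α := fun _ => ℂ) (y x) (v k)) :=
    (eventually_all_finset s).2 fun k _ => hreg _ (hv0 k) (hv1 k)
  have hpoly : ∀ᶠ x in 𝓝[≠] (0 : ℂ), (p (y x)).coeff (2 * K) = Z (y x) ∧
      ∀ t, SymplecticRegular (Fin.snoc (α := fun _ => ℂ) (y x) t) →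
        (p (y x)).eval t = t ^ K * Y (Fin.snoc (α := fun _ => ℂ) (y x) t) := by
    filter_upwards [hnodes] with x hx
    have hr : SymplecticRegular (y x) := (hx 0 (by simp [s])).of_snoc
    obtain ⟨q, hqd, hqc, hqe⟩ := exists_laurent_polynomial hr
    have hqp : q = p (y x) := by
      rw [hp]
      refine Lagrange.eq_interpolate_of_eval_eq _ hv ?_ fun k hk => ?_
      · rw [Finset.card_range]
        exact degree_le_natDegree.trans_lt (by exact_mod_cast Nat.lt_succ_of_le hqd)
      · rw [hqe _ (hx k hk), hval _ _ (hx k hk)]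
    rw [← hqp, hqc, hZ.2 _ (fun i => (hr.1 i).1) hr.sdet_deltaE_ne_zero]
    exact ⟨rfl, fun t ht => by rw [hqe t ht, hval _ _ ht]⟩
  have hcoeff : (p z).coeff (2 * K) = Z z := by
    refine tendsto_nhds_unique_of_eventuallyEq (l := 𝓝[≠] (0 : ℂ))
      (f := fun x => (p (y x)).coeff (2 * K)) ?_ (hZ.tendsto hz hy hy0)
      (hpoly.mono fun x hx => hx.1)
    simp only [p, finsetSum_coeff, coeff_C_mul]
    exact tendsto_finsetSum _ fun k _ =>
      ((hYlim _ (hv0 k)).const_mul _).mul_const _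
  have heval : ∀ t, t ≠ 0 → t ^ 2 ≠ 1 →
      (p z).eval t = t ^ K * Y (Fin.snoc (α := fun _ => ℂ) z t) := fun t ht ht' => by
    refine tendsto_nhds_unique_of_eventuallyEq (l := 𝓝[≠] (0 : ℂ))
      (f := fun x => (p (y x)).eval t) ?_ ((hYlim t ht).const_mul _)
      ((hpoly.and (hreg t ht ht')).mono fun x hx => hx.1.2 t hx.2)
    simp only [p, eval_finsetSum, eval_mul, eval_C]
    exact tendsto_finsetSum _ fun k _ =>
      ((hYlim _ (hv0 k)).const_mul _).mul_const _
  have hdeg : (p z).natDegree ≤ 2 * K := by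
    rw [hp]
    have := Lagrange.degree_interpolate_lt
      (fun k => v k ^ K * Y (Fin.snoc (α := fun _ => ℂ) z (v k))) hv
    rw [Finset.card_range] at this
    exact natDegree_le_iff_degree_le.2 (Order.le_of_lt_succ this)
  rw [← hcoeff]
  refine (tendsto_zpow_neg_mul_eval hdeg).congr' ?_
  filter_upwards [eventually_gt_atTop 1] with t ht
  have ht0 : (t : ℂ) ≠ 0 := by exact_mod_cast (zero_lt_one.trans ht).ne'
  have ht1 : (t : ℂ) ^ 2 ≠ 1 := by
    have : t ^ 2 ≠ 1 := by nlinarith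
    exact_mod_cast this
  rw [heval _ ht0 ht1, zpow_neg, zpow_neg, zpow_natCast, zpow_natCast, two_mul, pow_add]
  field_simp

/-- **Equation (38).** As the last argument `t → +∞` along the reals,
`t^{−(⌈N/2⌉−1)} χ_N(z_1, …, z_{N−1}, t) → χ_{N−1}(z_1, …, z_{N−1})`. -/
theorem sympl_char_last_variable_limit (N : ℕ) (hN : 2 ≤ N)
    (XN : (Fin N → ℂ) → ℂ) (hXN : IsSymplecticExt N XN)
    (XN1 : (Fin (N-1) → ℂ) → ℂ) (hXN1 : IsSymplecticExt (N-1) XN1)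
    (z : Fin (N-1) → ℂ) (hz : ∀ i, z i ≠ 0) :
    Filter.Tendsto
      (fun t : ℝ => (t:ℂ) ^ (-(((N+1)/2 - 1 : ℕ) : ℤ)) *
        XN (fun i : Fin N => if h : i.1 < N - 1 then z ⟨i.1, h⟩ else (t:ℂ)))
      Filter.atTop (nhds (XN1 z)) := by
  obtain ⟨n, rfl⟩ : ∃ n, N = n + 1 := ⟨N - 1, by omega⟩
  have hexp : (n + 1 + 1) / 2 - 1 = n / 2 := by omega
  rw [hexp]
  refine (hXN.tendsto_snoc hXN1 hz).congr fun t => ?_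
  congr 2

end
end
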